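/- For every integer n ≥ 5, every subgroup of the generalised Higman group H_n satisfies the following Tits alternative: it is cyclic, or it admits an injective group homomorphism into the Baumslag–Solitar group BS(1,2), or it contains a non-abelian free subgroup. -/

import Mathlib

def higmanRels (n : ℕ) : Set (FreeGroup (ZMod n)) :=
  {r | ∃ i : ZMod n,
    r = FreeGroup.of i * FreeGroup.of (i + 1) * (FreeGroup.of i)⁻¹ * ((FreeGroup.of (i + 1))⁻¹) ^ 2}

abbrev HigmanGroup (n : ℕ) : Type := PresentedGroup (higmanRels n)

def bsRels : Set (FreeGroup (Fin 2)) :=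
  {FreeGroup.of 0 * FreeGroup.of 1 * (FreeGroup.of 0)⁻¹ * ((FreeGroup.of 1)⁻¹) ^ 2}

abbrev BS12 : Type := PresentedGroup bsRels

def HasFreeSubgroup (G : Type*) [Group G] : Prop :=
  ∃ f : FreeGroup (Fin 2) →* G, Function.Injective f

/-- An integral tree metric: a nonnegative integer valued metric satisfying the four point
condition, the parity condition and existence of geodesics. -/
structure TreeMetric (V : Type*) where
  d : V → V → ℕ
  eq_of_d : ∀ {x y}, d x y = 0 → x = y
  d_self : ∀ x, d x x = 0
  symm : ∀ x y, d x y = d y x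
  four : ∀ x y z w, d x y + d z w ≤ d x z + d y w ∨ d x y + d z w ≤ d x w + d y z
  parity : ∀ x y z, Even (d x y + d y z + d x z)
  geod : ∀ x y k, k ≤ d x y → ∃ z, d x z = k ∧ d x z + d z y = d x y

namespace TreeMetric

variable {V : Type*} (T : TreeMetric V)

lemma four_all (x y z w : V) :
    (T.d x y + T.d z w ≤ T.d x z + T.d y w ∨ T.d x y + T.d z w ≤ T.d x w + T.d y z) ∧
    (T.d x z + T.d y w ≤ T.d x y + T.d z w ∨ T.d x z + T.d y w ≤ T.d x w + T.d y z) ∧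
    (T.d x w + T.d y z ≤ T.d x y + T.d z w ∨ T.d x w + T.d y z ≤ T.d x z + T.d y w) := by
  have h1 := T.four x y z w
  have h2 := T.four x z y w
  have h3 := T.four x w y z
  rw [T.symm z y] at h2
  rw [T.symm w z, T.symm w y] at h3
  exact ⟨h1, h2, h3⟩

lemma triangle (x y z : V) : T.d x z ≤ T.d x y + T.d y z := by
  have h := T.four x z y y
  have := T.d_self y
  have := T.symm z y
  omega

lemma eq_of_between {x w z z' : V} (h : T.d x z + T.d z w = T.d x w)
    (h' : T.d x z' + T.d z' w = T.d x w) (e : T.d x z = T.d x z') : z = z' := by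
  apply T.eq_of_d
  have := T.four z z' x w
  have := T.symm z x
  have := T.symm z' x
  have := T.symm x w
  omega

section Action

variable {G : Type*} [Group G] [MulAction G V]

/-- The action preserves the metric and the bipartition. -/
structure Acts (G : Type*) [Group G] [MulAction G V] : Prop where
  iso : ∀ (g : G) x y, T.d (g • x) (g • y) = T.d x y
  even : ∀ (g : G) x, Even (T.d x (g • x))

/-- Nontrivial elements do not fix points at distance at least three. -/
def Acylindrical (G : Type*) [Group G] [MulAction G V] : Prop :=
  ∀ (g : G) x y, g • x = x → g • y = y → 3 ≤ T.d x y → g = 1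

/-- `g` is a hyperbolic isometry whose axis passes through `x`. -/
def Hyp (g : G) (x : V) : Prop :=
  0 < T.d x (g • x) ∧ T.d x (g • g • x) = 2 * T.d x (g • x)

variable {T}

lemma Acts.d_inv (hT : T.Acts G) (g : G) (x y : V) : T.d (g⁻¹ • x) y = T.d x (g • y) := by
  rw [← hT.iso g, smul_inv_smul]

lemma fixed_of_between (hT : T.Acts G) {g : G} {x y z : V} (hx : g • x = x) (hy : g • y = y)
    (hz : T.d x z + T.d z y = T.d x y) : g • z = z := by
  have h1 := hT.iso g x z
  have h2 := hT.iso g z y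
  rw [hx] at h1
  rw [hy] at h2
  exact T.eq_of_between (x := x) (w := y) (by omega) hz h1

lemma midpoint_fixed (hT : T.Acts G) {g : G} {q r m : V} (hq : g • q = q)
    (h1 : T.d r m = T.d m (g • r)) (h2 : T.d r m + T.d m (g • r) = T.d r (g • r)) :
    g • m = m := by
  have a1 := hT.iso g q r
  have a2 := hT.iso g q m
  have a3 := hT.iso g m r
  rw [hq] at a1 a2
  have := T.four_all q m r (g • r)
  have := T.symm m r
  have := T.symm (g • r) m
  have := T.triangle q m r
  refine T.eq_of_between (x := q) (w := g • r) ?_ ?_ ?_ <;> omega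

lemma exists_midpoint (T : TreeMetric V) {x y : V} (h : Even (T.d x y)) :
    ∃ m, T.d x m = T.d m y ∧ T.d x m + T.d m y = T.d x y := by
  obtain ⟨k, hk⟩ := h
  obtain ⟨m, h1, h2⟩ := T.geod x y k (by omega)
  exact ⟨m, by omega, h2⟩

lemma common_fixed (hT : T.Acts G) {g h : G} {p q r : V} (hp : g • p = p) (hq : h • q = q)
    (hr : (g * h) • r = r) : ∃ m : V, g • m = m ∧ h • m = m := by
  obtain ⟨m, h1, h2⟩ := exists_midpoint T (hT.even h r)
  refine ⟨m, ?_, midpoint_fixed hT hq h1 h2⟩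
  have e : g • h • r = r := by rwa [mul_smul] at hr
  refine midpoint_fixed hT (r := h • r) hp ?_ ?_
  · rw [e, T.symm _ m, T.symm m r, h1]
  · rw [e, T.symm _ m, T.symm m r, T.symm _ r]; omega

lemma exists_hyp (hT : T.Acts G) {g : G} (hg : ∀ x : V, g • x ≠ x) [Nonempty V] :
    ∃ x : V, T.Hyp g x := by
  obtain ⟨x, hx⟩ : ∃ x : V, ∀ y, T.d x (g • x) ≤ T.d y (g • y) := by
    let f : V → ℕ := fun x => T.d x (g • x)
    exact ⟨Function.argmin f, fun y => Function.argmin_le f y⟩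
  have hpos : 0 < T.d x (g • x) := by
    rcases Nat.eq_zero_or_pos (T.d x (g • x)) with h | h
    · exact absurd (T.eq_of_d h).symm (hg x)
    · exact h
  refine ⟨x, hpos, ?_⟩
  by_contra hne
  have e0 := hT.even g x
  have e1 := hT.iso g x (g • x)
  have e2 := T.triangle x (g • x) (g • g • x)
  have e3 := T.parity x (g • x) (g • g • x)
  obtain ⟨a, ha⟩ := e0
  obtain ⟨b, hb⟩ := e3
  obtain ⟨y, hy1, hy2⟩ := T.geod (g • x) x 1 (by rw [T.symm]; exact hpos)
  have s1 := T.symm (g • x) x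
  have f1 := T.four_all (g • x) x y (g • g • x)
  have t1 := T.triangle (g • x) y (g • g • x)
  have s2 := T.symm x y
  have p1 := T.parity (g • x) y (g • g • x)
  have p2 : T.d y (g • g • x) = T.d (g⁻¹ • y) (g • x) := hT.d_inv _ _ _ |>.symm
  have p3 : T.d (g • x) y = T.d x (g⁻¹ • y) := by
    rw [T.symm, ← hT.d_inv, T.symm]
  have p4 := hx (g⁻¹ • y)
  rw [smul_inv_smul] at p4
  have f2 := T.four_all x (g • x) y (g⁻¹ • y)
  have s3 := T.symm (g⁻¹ • y) (g • x)
  have s4 := T.symm (g⁻¹ • y) y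
  obtain ⟨c, hc⟩ := p1
  omega

lemma Hyp.pow (hT : T.Acts G) {g : G} {x : V} (h : T.Hyp g x) (n : ℕ) :
    T.d x (g ^ n • x) = n * T.d x (g • x) := by
  suffices H : T.d x (g ^ n • x) = n * T.d x (g • x) ∧
      T.d x (g ^ (n + 1) • x) = (n + 1) * T.d x (g • x) from H.1
  induction n with
  | zero => simp [T.d_self]
  | succ n ih =>
    refine ⟨by exact_mod_cast ih.2, ?_⟩
    obtain ⟨h0, h2⟩ := h
    have a1 : T.d (g ^ n • x) (g ^ (n + 1) • x) = T.d x (g • x) := by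
      rw [pow_succ, mul_smul, hT.iso]
    have a2 : T.d (g ^ (n + 1) • x) (g ^ (n + 1 + 1) • x) = T.d x (g • x) := by
      rw [pow_succ g (n + 1), mul_smul, hT.iso]
    have a3 : T.d (g ^ n • x) (g ^ (n + 1 + 1) • x) = 2 * T.d x (g • x) := by
      rw [pow_succ g (n + 1), pow_succ g n, mul_smul, mul_smul, hT.iso, h2]
    have := T.four_all x (g ^ n • x) (g ^ (n + 1) • x) (g ^ (n + 1 + 1) • x)
    ring_nf at *
    omega

lemma Hyp.inv (hT : T.Acts G) {g : G} {x : V} (h : T.Hyp g x) : T.Hyp g⁻¹ x := by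
  obtain ⟨h0, h2⟩ := h
  have a : T.d x (g⁻¹ • x) = T.d x (g • x) := by rw [T.symm, hT.d_inv]
  refine ⟨by omega, ?_⟩
  rw [a, T.symm, hT.d_inv, hT.d_inv, h2]

lemma Hyp.d_inv (hT : T.Acts G) {g : G} {x : V} : T.d x (g⁻¹ • x) = T.d x (g • x) := by
  rw [T.symm, hT.d_inv]

lemma Hyp.conj (hT : T.Acts G) {h : G} {x : V} (hh : T.Hyp h x) (g : G) :
    T.Hyp (g * h * g⁻¹) (g • x) := by
  simpa [Hyp, mul_smul, hT.iso] using hh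

lemma conj_d (hT : T.Acts G) {h : G} {x : V} (g : G) :
    T.d (g • x) ((g * h * g⁻¹) • g • x) = T.d x (h • x) := by
  simp [mul_smul, hT.iso]

lemma Hyp.ne_one (hT : T.Acts G) {g : G} {x : V} (h : T.Hyp g x) {n : ℕ} (hn : n ≠ 0) :
    g ^ n ≠ 1 := by
  intro e
  have := h.pow hT n
  rw [e, one_smul, T.d_self] at this
  have := h.1
  have : n * T.d x (g • x) ≠ 0 := Nat.mul_ne_zero hn (by omega)
  omega

lemma injective_lift_of_length (hT : T.Acts G) {α : Type*} (u : α → G) (x : V)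
    (h : ∀ a b : α × Bool, ¬ (a.1 = b.1 ∧ a.2 ≠ b.2) →
      T.d x (cond a.2 (u a.1) (u a.1)⁻¹ • x) <
        T.d x ((cond a.2 (u a.1) (u a.1)⁻¹ * cond b.2 (u b.1) (u b.1)⁻¹) • x) ∧
      T.d x (cond b.2 (u b.1) (u b.1)⁻¹ • x) <
        T.d x ((cond a.2 (u a.1) (u a.1)⁻¹ * cond b.2 (u b.1) (u b.1)⁻¹) • x)) :
    Function.Injective (FreeGroup.lift u) := by
  classical
  set s : α × Bool → G := fun a => cond a.2 (u a.1) (u a.1)⁻¹ with hs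
  have key : ∀ (L : List (α × Bool)) (a : α × Bool), FreeGroup.IsReduced (a :: L) →
      T.d x ((L.map s).prod • x) < T.d x (((a :: L).map s).prod • x) := by
    intro L
    induction L with
    | nil =>
      intro a _
      have h1 := (h a a (by simp)).1
      have h2 := T.triangle x (s a • x) ((s a * s a) • x)
      have h3 := hT.iso (s a) x (s a • x)
      rw [← mul_smul] at h3
      have h4 := T.d_self x
      simp only [List.map_nil, List.prod_nil, one_smul, List.map_cons, mul_one, List.prod_cons]
      change T.d x (s a • x) < T.d x ((s a * s a) • x) at h1
      omega
    | cons b L ih =>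
      intro a hab
      have hr : FreeGroup.IsReduced (b :: L) := by
        simp only [FreeGroup.IsReduced] at hab ⊢
        exact hab.tail
      have hne : ¬ (a.1 = b.1 ∧ a.2 ≠ b.2) := by
        simp only [FreeGroup.IsReduced, List.isChain_cons_cons] at hab
        have := hab.1
        tauto
      have i1 := ih b hr
      obtain ⟨h1, h2⟩ := h a b hne
      change T.d x (s a • x) < T.d x ((s a * s b) • x) at h1
      change T.d x (s b • x) < T.d x ((s a * s b) • x) at h2
      simp only [List.map_cons, List.prod_cons, mul_smul] at *
      set P := (List.map s L).prod • x
      have f := T.four_all (s b • P) x (s b • x) ((s a)⁻¹ • x)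
      have e1 := T.symm x (s b • P)
      have e2 := hT.iso (s b) P x
      have e3 := T.symm P x
      have e4 := hT.d_inv (s a) x (s b • P)
      have e5 := T.symm ((s a)⁻¹ • x) (s b • P)
      have e6 := hT.d_inv (s a) x (s b • x)
      have e7 := T.symm ((s a)⁻¹ • x) (s b • x)
      have e8 := hT.d_inv (s a) x x
      have e9 := T.symm ((s a)⁻¹ • x) x
      omega
  rw [injective_iff_map_eq_one]
  intro w hw
  by_contra hne
  have hred := FreeGroup.isReduced_toWord (x := w)
  have hw' : ((w.toWord).map s).prod = 1 := by
    rw [← hw]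
    conv_rhs => rw [← FreeGroup.mk_toWord (x := w), FreeGroup.lift_mk]
  cases hL : w.toWord with
  | nil => exact hne (FreeGroup.toWord_eq_nil_iff.1 hL)
  | cons a L =>
    rw [hL] at hred hw'
    have := key L a hred
    rw [hw', one_smul, T.d_self] at this
    omega

end Action
end TreeMetric

namespace TreeMetric
section Action
variable {V : Type*} {T : TreeMetric V} {G : Type*} [Group G] [MulAction G V]

lemma Hyp.shift (hT : T.Acts G) {h : G} {x z : V} (hh : T.Hyp h x) {N : ℕ}
    (hz : T.d x z + T.d z (h ^ N • x) = T.d x (h ^ N • x))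
    (hl : T.d x z + T.d x (h • x) ≤ T.d x (h ^ N • x)) :
    T.d x (h • z) = T.d x z + T.d x (h • x) ∧
      T.d x (h • z) + T.d (h • z) (h ^ N • x) = T.d x (h ^ N • x) := by
  have a1 := hh.pow hT N
  have a2 := hh.pow hT (N + 1)
  rw [Nat.succ_mul] at a2
  have e : h ^ (N + 1) • x = h • h ^ N • x := by rw [pow_succ', mul_smul]
  rw [e] at a2
  have a3 := hT.iso h x z
  have a4 := hT.iso h z (h ^ N • x)
  have a5 : T.d (h ^ N • x) (h • h ^ N • x) = T.d x (h • x) := by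
    rw [← e, pow_succ, mul_smul, hT.iso]
  have t1 := T.triangle x (h • x) (h • z)
  have t2 := T.triangle x (h • z) (h • h ^ N • x)
  have f := T.four_all x (h ^ N • x) (h • h ^ N • x) (h • z)
  have s1 := T.symm (h • h ^ N • x) (h • z)
  have s2 := T.symm (h ^ N • x) (h • z)
  have t3 := T.triangle x (h • z) (h ^ N • x)
  omega

lemma between_transfer (T : TreeMetric V) {x y X Y z : V} {L c : ℕ} (hx : T.d x X = L)
    (hy : T.d y Y = L) (hc : T.d x y = c) (hXY : T.d X Y ≤ L + 3 * c)
    (hz : T.d x z + T.d z X = L) (h1 : c ≤ T.d x z) (h2 : 2 * T.d x z + 4 * c ≤ L) :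
    T.d y z + T.d z Y = L := by
  have f1 := T.four_all x X y z
  have f2 := T.four_all x X Y z
  have f3 := T.four_all x X y Y
  have f4 := T.four_all x z y Y
  have s1 := T.symm X z
  have s2 := T.symm X y
  have s3 := T.symm Y z
  have s4 := T.symm y z
  have t := T.triangle y z Y
  have t := T.triangle x y Y
  have t := T.triangle z X Y
  have t := T.triangle y x z
  have s5 := T.symm x y
  omega

lemma Hyp.smul_eq_of_overlap (hT : T.Acts G) {h k : G} {x y z : V} (hh : T.Hyp h x)
    (hk : T.Hyp k y) (hl : T.d x (h • x) = T.d y (k • y)) {N : ℕ}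
    (hXY : T.d (h ^ N • x) (k ^ N • y) ≤ N * T.d x (h • x) + 3 * T.d x y)
    (hz : T.d x z + T.d z (h ^ N • x) = T.d x (h ^ N • x))
    (h1 : T.d x y < T.d x z)
    (h2 : 2 * (T.d x z + T.d x (h • x)) + 6 * T.d x y ≤ N * T.d x (h • x)) :
    h • z = k • z := by
  have a1 := hh.pow hT N
  have a2 := hk.pow hT N
  rw [← hl] at a2
  obtain ⟨b1, b2⟩ := hh.shift hT hz (by omega)
  have c1 := between_transfer T a1 a2 rfl hXY (hz.trans a1) (by omega) (by omega)
  have c2 := between_transfer T a1 a2 rfl hXY (b2.trans a1) (by omega) (by omega)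
  have t := T.triangle y x z
  have s5 := T.symm x y
  obtain ⟨d1, d2⟩ := hk.shift hT (z := z) (c1.trans a2.symm) (by omega)
  refine T.eq_of_between (x := y) (w := k ^ N • y) (c2.trans a2.symm) d2 ?_
  have e : T.d z (h • z) = T.d x (h • x) := by
    clear c1 c2 d1 d2 t s5 hXY h1 h2
    have f1 := T.four_all x (h ^ N • x) z (h • z)
    have s1 := T.symm (h ^ N • x) z
    have s2 := T.symm (h ^ N • x) (h • z)
    have t1 := T.triangle x z (h • z)
    omega
  rw [d1, ← hl]
  clear c1 c2 d1 d2 hXY h2 a1 a2 hz b2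
  have f2 := T.four_all x y z (h • z)
  omega

lemma Hyp.eq_of_overlap (hT : T.Acts G) (hac : T.Acylindrical G) {h k : G} {x y : V}
    (hh : T.Hyp h x) (hk : T.Hyp k y) (hl : T.d x (h • x) = T.d y (k • y)) {N : ℕ}
    (hN : 20 * (T.d x y + T.d x (h • x) + 4) ≤ N * T.d x (h • x))
    (hXY : T.d (h ^ N • x) (k ^ N • y) ≤ N * T.d x (h • x) + 3 * T.d x y) : h = k := by
  have a1 := hh.pow hT N
  obtain ⟨z, hz, hz'⟩ := T.geod x (h ^ N • x) (T.d x y + 1) (by omega)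
  obtain ⟨w, hw, hw'⟩ := T.geod x (h ^ N • x) (T.d x y + 4) (by omega)
  have e1 := hh.smul_eq_of_overlap hT hk hl hXY hz' (by omega) (by omega)
  have e2 := hh.smul_eq_of_overlap hT hk hl hXY hw' (by omega) (by omega)
  have := hac (k⁻¹ * h) z w (by rw [mul_smul, e1, inv_smul_smul])
    (by rw [mul_smul, e2, inv_smul_smul]) (by
      have := T.triangle x z w
      omega)
  rwa [inv_mul_eq_one, eq_comm] at this

lemma Hyp.cond (hT : T.Acts G) {h : G} {x : V} (hh : T.Hyp h x) (e : Bool) :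
    T.Hyp (cond e h h⁻¹) x ∧ T.d x ((cond e h h⁻¹ : G) • x) = T.d x (h • x) := by
  cases e
  · exact ⟨hh.inv hT, Hyp.d_inv hT⟩
  · exact ⟨hh, rfl⟩

lemma injective_lift_of_far (hT : T.Acts G) {h k : G} {x y : V} (hh : T.Hyp h x)
    (hk : T.Hyp k y) (hl : T.d x (h • x) = T.d y (k • y)) {N : ℕ}
    (hN : 20 * (T.d x y + T.d x (h • x) + 4) ≤ N * T.d x (h • x))
    (hfar : ∀ e f : Bool, N * T.d x (h • x) + 3 * T.d x y <
      T.d ((cond e h h⁻¹ : G) ^ N • x) ((cond f k k⁻¹ : G) ^ N • y)) :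
    Function.Injective (FreeGroup.lift ![h ^ N, k ^ N]) := by
  have sg : ∀ (e : Bool) (g : G), (cond e (g ^ N) (g ^ N)⁻¹ : G) = (cond e g g⁻¹ : G) ^ N := by
    intro e g; cases e <;> simp
  have ng : ∀ (e : Bool) (g : G), ((cond e g g⁻¹ : G) ^ N)⁻¹ = (cond (!e) g g⁻¹ : G) ^ N := by
    intro e g; cases e <;> simp
  have lenh : ∀ e : Bool, T.d x ((cond e h h⁻¹ : G) ^ N • x) = N * T.d x (h • x) := by
    intro e; rw [(hh.cond hT e).1.pow hT, (hh.cond hT e).2]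
  have lenh2 : ∀ e : Bool, T.d x (((cond e h h⁻¹ : G) ^ N * (cond e h h⁻¹ : G) ^ N) • x)
      = 2 * (N * T.d x (h • x)) := by
    intro e; rw [← pow_add, (hh.cond hT e).1.pow hT, (hh.cond hT e).2]; ring
  have lenk : ∀ e : Bool, T.d x ((cond e k k⁻¹ : G) ^ N • x) ≤
      N * T.d x (h • x) + 2 * T.d x y := by
    intro e
    have a := (hk.cond hT e).1.pow hT N
    rw [(hk.cond hT e).2, ← hl] at a
    have t1 := T.triangle x y ((cond e k k⁻¹ : G) ^ N • x)
    have t2 := T.triangle y ((cond e k k⁻¹ : G) ^ N • y) ((cond e k k⁻¹ : G) ^ N • x)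
    rw [hT.iso, T.symm y x] at t2
    omega
  have lenk2 : ∀ e : Bool, 2 * (N * T.d x (h • x)) ≤
      T.d x (((cond e k k⁻¹ : G) ^ N * (cond e k k⁻¹ : G) ^ N) • x) + 2 * T.d x y := by
    intro e
    have a := (hk.cond hT e).1.pow hT (N + N)
    rw [(hk.cond hT e).2, ← hl, add_mul] at a
    rw [← pow_add]
    have t1 := T.triangle y x ((cond e k k⁻¹ : G) ^ (N + N) • y)
    have t2 := T.triangle x ((cond e k k⁻¹ : G) ^ (N + N) • x) ((cond e k k⁻¹ : G) ^ (N + N) • y)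
    rw [hT.iso] at t2
    rw [T.symm y x] at t1
    omega
  have far : ∀ e f : Bool, N * T.d x (h • x) + 2 * T.d x y <
      T.d ((cond e h h⁻¹ : G) ^ N • x) ((cond f k k⁻¹ : G) ^ N • x) := by
    intro e f
    have a := hfar e f
    have t := T.triangle ((cond e h h⁻¹ : G) ^ N • x) ((cond f k k⁻¹ : G) ^ N • x)
      ((cond f k k⁻¹ : G) ^ N • y)
    rw [hT.iso] at t
    omega
  have farhk : ∀ e f : Bool, N * T.d x (h • x) + 2 * T.d x y <
      T.d x (((cond e h h⁻¹ : G) ^ N * (cond f k k⁻¹ : G) ^ N) • x) := by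
    intro e f
    rw [mul_smul, ← hT.d_inv ((cond e h h⁻¹ : G) ^ N) x, ng]
    exact far _ _
  have farkh : ∀ e f : Bool, N * T.d x (h • x) + 2 * T.d x y <
      T.d x (((cond e k k⁻¹ : G) ^ N * (cond f h h⁻¹ : G) ^ N) • x) := by
    intro e f
    rw [mul_smul, ← hT.d_inv ((cond e k k⁻¹ : G) ^ N) x, ng,
      T.symm (_ • _) (_ • _)]
    exact far _ _
  apply injective_lift_of_length hT _ x
  rintro ⟨i, e⟩ ⟨j, f⟩ hij
  have l1 := lenh e
  have l2 := lenh f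
  have l3 := lenk e
  have l4 := lenk f
  fin_cases i <;> fin_cases j <;> simp only [Fin.zero_eta, Fin.mk_one, Matrix.cons_val_zero,
    Matrix.cons_val_one, sg]
  · have : f = e := by by_contra hne; exact hij ⟨rfl, fun h => hne h.symm⟩
    subst this
    have := lenh2 f
    omega
  · have := farhk e f
    omega
  · have := farkh e f
    omega
  · have : f = e := by by_contra hne; exact hij ⟨rfl, fun h => hne h.symm⟩
    subst this
    have := lenk2 f
    omega

lemma Hyp.conj_or_free (hT : T.Acts G) (hac : T.Acylindrical G) {h : G} {x : V}
    (hh : T.Hyp h x) (g : G) : g * h * g⁻¹ = h ∨ g * h * g⁻¹ = h⁻¹ ∨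
      ∃ f : FreeGroup (Fin 2) →* G, Function.Injective f := by
  have hk := hh.conj hT g
  have hl := (conj_d hT (h := h) (x := x) g).symm
  set k := g * h * g⁻¹
  set y := g • x
  have hN : 20 * (T.d x y + T.d x (h • x) + 4) ≤
      (20 * (T.d x y + T.d x (h • x) + 4)) * T.d x (h • x) :=
    Nat.le_mul_of_pos_right _ hh.1
  by_cases hfar : ∀ e f : Bool, (20 * (T.d x y + T.d x (h • x) + 4)) * T.d x (h • x) +
      3 * T.d x y < T.d ((_root_.cond e h h⁻¹ : G) ^ (20 * (T.d x y + T.d x (h • x) + 4)) • x)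
        ((_root_.cond f k k⁻¹ : G) ^ (20 * (T.d x y + T.d x (h • x) + 4)) • y)
  · exact Or.inr (Or.inr ⟨_, injective_lift_of_far hT hh hk hl hN hfar⟩)
  · push Not at hfar
    obtain ⟨e, f, hef⟩ := hfar
    have e1 := hh.cond hT e
    have e2 := hk.cond hT f
    have := Hyp.eq_of_overlap hT hac e1.1 e2.1 (by rw [e1.2, e2.2, hl])
      (N := 20 * (T.d x y + T.d x (h • x) + 4)) (by rw [e1.2]; exact hN) (by rw [e1.2]; exact hef)
    rw [← or_assoc]
    left
    cases e <;> cases f <;> simp only [cond_true, cond_false] at this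
    · left; exact (inv_injective this).symm
    · right; exact this.symm
    · right; rw [this, inv_inv]
    · left; exact this.symm

lemma eq_one_of_commute (hT : T.Acts G) (hac : T.Acylindrical G) {h g : G} {x p : V}
    (hh : T.Hyp h x) (hc : g * h = h * g) (hp : g • p = p) : g = 1 := by
  have key : ∀ n : ℕ, g • h ^ n • p = h ^ n • p := by
    intro n
    rw [← mul_smul, ((show Commute g h from hc).pow_right n).eq, mul_smul, hp]
  have a := hh.pow hT (2 * T.d x p + 3)
  refine hac g p _ hp (key (2 * T.d x p + 3)) ?_
  have t1 := T.triangle x p (h ^ (2 * T.d x p + 3) • x)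
  have t2 := T.triangle p (h ^ (2 * T.d x p + 3) • p) (h ^ (2 * T.d x p + 3) • x)
  rw [hT.iso, T.symm p x] at t2
  have := Nat.le_mul_of_pos_right (2 * T.d x p + 3) hh.1
  omega

lemma Hyp.central_or_free (hT : T.Acts G) (hac : T.Acylindrical G) (h2 : ∀ g : G, g * g = 1 → g = 1)
    (hfree : ¬ ∃ f : FreeGroup (Fin 2) →* G, Function.Injective f) {h : G} {x : V}
    (hh : T.Hyp h x) (g : G) : g * h = h * g := by
  rcases hh.conj_or_free hT hac g with e | e | e
  · rwa [mul_inv_eq_iff_eq_mul] at e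
  · exfalso
    have hne : h ≠ h⁻¹ := by
      intro e'
      have := hh.ne_one hT (n := 2) (by norm_num)
      rw [pow_two] at this
      exact this (mul_eq_one_iff_eq_inv.2 e')
    by_cases hg : ∃ p : V, g • p = p
    · obtain ⟨p, hp⟩ := hg
      have : g * g = 1 := by
        refine eq_one_of_commute hT hac hh (p := p) ?_ (by rw [mul_smul, hp, hp])
        have e1 : g * h = h⁻¹ * g := by rwa [mul_inv_eq_iff_eq_mul] at e
        have e2 : g * h⁻¹ = h * g := by
          have : (g * h * g⁻¹)⁻¹ = h := by rw [e, inv_inv]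
          simp only [mul_inv_rev, inv_inv] at this
          rw [← mul_assoc, mul_inv_eq_iff_eq_mul] at this
          exact this
        rw [mul_assoc, e1, ← mul_assoc, e2, mul_assoc]
      have := h2 g this
      subst this
      simp at e
      exact hne e
    · push Not at hg
      obtain ⟨z, hz⟩ := haveI : Nonempty V := ⟨x⟩; exists_hyp hT hg
      rcases hz.conj_or_free hT hac h with e' | e' | e'
      · apply hne
        rw [mul_inv_eq_iff_eq_mul] at e'
        rw [← e, eq_mul_inv_iff_mul_eq]
        exact e'
      · have e3 : g * g = h⁻¹ * h⁻¹ := by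
          have : g * h * g⁻¹ * h⁻¹ = g * g := by
            have : h * g⁻¹ * h⁻¹ = g := by
              rw [show h * g⁻¹ * h⁻¹ = (h * g * h⁻¹)⁻¹ by group, e', inv_inv]
            calc g * h * g⁻¹ * h⁻¹ = g * (h * g⁻¹ * h⁻¹) := by group
              _ = g * g := by rw [this]
          rw [← this, e]
        have e4 : g * (h⁻¹ * h⁻¹) * g⁻¹ = h * h := by
          have : g * (h⁻¹ * h⁻¹) * g⁻¹ = ((g * h * g⁻¹) * (g * h * g⁻¹))⁻¹ := by group
          rw [this, e]; simp
        rw [← e3] at e4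
        have e5 : g * g = h * h := by rw [← e4]; group
        have := hh.ne_one hT (n := 4) (by norm_num)
        apply this
        have : h ^ 4 = (h * h) * (h * h) := by simp [pow_succ, mul_assoc]
        rw [this]; nth_rewrite 1 [← e5]; rw [e3]; simp [mul_assoc]
      · exact hfree e'
  · exact absurd e hfree

lemma isCyclic_of_hyp (hT : T.Acts G) (hac : T.Acylindrical G) (h2 : ∀ g : G, g * g = 1 → g = 1)
    (hfree : ¬ ∃ f : FreeGroup (Fin 2) →* G, Function.Injective f)
    (hh : ∃ (h : G) (x : V), T.Hyp h x) : IsCyclic G := by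
  obtain ⟨h₀, x₀, hh₀⟩ := hh
  have : Nonempty V := ⟨x₀⟩
  have nofix : ∀ g : G, ∀ p : V, g • p = p → g = 1 := fun g p hp =>
    eq_one_of_commute hT hac hh₀ (hh₀.central_or_free hT hac h2 hfree g) hp
  have hcomm : ∀ h g : G, h * g = g * h := by
    intro h g
    by_cases h1 : g = 1
    · simp [h1]
    · obtain ⟨z, hz⟩ := exists_hyp hT (V := V) (T := T) (g := g) fun p hp => h1 (nofix g p hp)
      exact hz.central_or_free hT hac h2 hfree h
  have hne : h₀ ≠ 1 := by simpa using hh₀.ne_one hT (n := 1) one_ne_zero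
  obtain ⟨⟨⟨h, hh⟩, x⟩, hmin⟩ : ∃ p : {g : G // g ≠ 1} × V, ∀ q : {g : G // g ≠ 1} × V,
      T.d p.2 (p.1.1 • p.2) ≤ T.d q.2 (q.1.1 • q.2) := by
    have : Nonempty ({g : G // g ≠ 1} × V) := ⟨⟨h₀, hne⟩, x₀⟩
    let f : {g : G // g ≠ 1} × V → ℕ := fun p => T.d p.2 (p.1.1 • p.2)
    exact ⟨Function.argmin f, fun y => Function.argmin_le f y⟩
  simp only [Prod.forall, Subtype.forall] at hmin
  have hpos : 0 < T.d x (h • x) := by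
    rcases Nat.eq_zero_or_pos (T.d x (h • x)) with h' | h'
    · exact absurd (nofix h x (T.eq_of_d h').symm) hh
    · exact h'
  have hx : T.d x (h • h • x) = 2 * T.d x (h • x) := by
    obtain ⟨z, hz⟩ := exists_hyp hT (V := V) (T := T) (g := h) fun p hp => hh (nofix h p hp)
    have hne2 : h * h ≠ 1 := fun e => hh (h2 h e)
    have e1 := hmin h hh z
    have p := hT.iso h x (h • x)
    obtain ⟨m, hm1, hm2⟩ := exists_midpoint T (hT.even h x)
    have e2 := hmin h hh m
    have p1 := hT.iso h x m
    have p2 := hT.iso h m (h • x)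
    have t := T.triangle x (h • x) (h • h • x)
    have f1 := T.four_all x (h • h • x) m (h • m)
    have f2 := T.four_all x (h • x) m (h • m)
    have f3 := T.four_all m (h • m) (h • x) (h • h • x)
    have f4 := T.four_all x (h • x) m (h • h • x)
    have s1 := T.symm (h • h • x) (h • m)
    have s2 := T.symm (h • h • x) m
    have s3 := T.symm (h • x) m
    have s4 := T.symm (h • x) (h • m)
    have s5 := T.symm (h • x) (h • h • x)
    omega
  refine ⟨h, fun g => ?_⟩
  induction hn : T.d x (g • x) using Nat.strong_induction_on generalizing g with
  | _ n ih =>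
    by_cases hlt : T.d x (g • x) < T.d x (h • x)
    · have : g = 1 := by
        by_contra h1
        have := hmin g h1 x
        omega
      rw [this]; exact one_mem (Subgroup.zpowers h)
    · have q1 : T.d x ((h⁻¹ * g) • x) = T.d (h • x) (g • x) := by
        rw [mul_smul, T.symm, hT.d_inv, T.symm]
      have q2 : T.d x ((h * g) • x) = T.d x (h • g • x) := by rw [mul_smul]
      by_cases c1 : T.d x ((h⁻¹ * g) • x) < n
      · obtain ⟨k, hk⟩ := ih _ c1 _ rfl
        exact ⟨k + 1, by
          change h ^ (k + 1) = g
          rw [zpow_add, zpow_one, ← hcomm, show h ^ k = h⁻¹ * g from hk, mul_inv_cancel_left]⟩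
      by_cases c2 : T.d x ((h * g) • x) < n
      · obtain ⟨k, hk⟩ := ih _ c2 _ rfl
        exact ⟨k - 1, by
          change h ^ (k - 1) = g
          rw [zpow_sub, zpow_one, ← hcomm, show h ^ k = h * g from hk, inv_mul_cancel_left]⟩
      exfalso
      have e1 : h • g • x = g • h • x := by rw [← mul_smul, hcomm, mul_smul]
      have i1 : T.d (g • x) (h • g • x) = T.d x (h • x) := by rw [e1, hT.iso]
      have i2 : T.d (h • x) (h • g • x) = T.d x (g • x) := hT.iso _ _ _
      have i3 : T.d (h • h • x) (h • g • x) = T.d (h • x) (g • x) := hT.iso _ _ _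
      have i4 : T.d (h • x) (h • h • x) = T.d x (h • x) := hT.iso _ _ _
      have f1 := T.four_all x (h • x) (g • x) (h • g • x)
      have f2 := T.four_all x (h • x) (h • h • x) (h • g • x)
      omega

lemma exists_fixed_of_bounded (hT : T.Acts G) {x : V} {B : ℕ}
    (hB : ∀ g : G, T.d x (g • x) ≤ B) : ∃ m : V, ∀ g : G, g • m = m := by
  obtain ⟨g₀, hg₀⟩ : ∃ g₀ : G, ∀ g, T.d x (g • x) ≤ T.d x (g₀ • x) := by
    refine ⟨Function.argmin fun g : G => B - T.d x (g • x), fun g => ?_⟩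
    have h := Function.argmin_le (fun g : G => B - T.d x (g • x)) g
    have h1 := hB (Function.argmin fun g : G => B - T.d x (g • x))
    have h2 := hB g
    omega
  obtain ⟨m, h1, h2⟩ := exists_midpoint T (hT.even g₀ x)
  have hdiam : ∀ g g' : G, T.d (g • x) (g' • x) ≤ T.d x (g₀ • x) := by
    intro g g'
    have := hg₀ (g⁻¹ * g')
    rwa [mul_smul, T.symm x, hT.d_inv, T.symm] at this
  have hm : ∀ g : G, T.d m (g • x) ≤ T.d x m := by
    intro g
    have := T.four_all x (g₀ • x) m (g • x)
    have a := hg₀ g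
    have b := hdiam g₀ g
    have := T.symm (g₀ • x) m
    omega
  refine ⟨m, fun g => ?_⟩
  have hm' : ∀ k : G, T.d (g • m) (k • x) ≤ T.d x m := by
    intro k
    have := hm (g⁻¹ * k)
    rwa [mul_smul, T.symm, hT.d_inv, T.symm] at this
  have a1 := hm' 1
  have a2 := hm' g₀
  rw [one_smul] at a1
  have t := T.triangle x (g • m) (g₀ • x)
  have s := T.symm x (g • m)
  exact T.eq_of_between (x := x) (w := g₀ • x) (by omega) h2 (by omega)

theorem acylindrical_alternative [Nonempty V] (hT : T.Acts G) (hac : T.Acylindrical G)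
    (h2 : ∀ g : G, g * g = 1 → g = 1) :
    (∃ x : V, ∀ g : G, g • x = x) ∨ IsCyclic G ∨
      ∃ f : FreeGroup (Fin 2) →* G, Function.Injective f := by
  by_cases hfree : ∃ f : FreeGroup (Fin 2) →* G, Function.Injective f
  · exact Or.inr (Or.inr hfree)
  by_cases hh : ∃ (h : G) (x : V), T.Hyp h x
  · exact Or.inr (Or.inl (isCyclic_of_hyp hT hac h2 hfree hh))
  left
  have hell : ∀ g : G, ∃ p : V, g • p = p := by
    intro g
    by_contra hg
    push Not at hg
    exact hh ⟨g, exists_hyp hT hg⟩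
  by_cases htriv : ∀ g : G, g = 1
  · exact ⟨Classical.arbitrary V, fun g => by rw [htriv g, one_smul]⟩
  push Not at htriv
  obtain ⟨h, h1⟩ := htriv
  obtain ⟨x, hx⟩ := hell h
  refine exists_fixed_of_bounded hT (x := x) (B := 4) fun g => ?_
  obtain ⟨q, hq⟩ := hell g
  obtain ⟨r, hr⟩ := hell (h * g)
  obtain ⟨m, m1, m2⟩ := common_fixed hT hx hq hr
  have : T.d x m ≤ 2 := by
    by_contra hlt
    exact h1 (hac h x m hx m1 (by omega))
  have t := T.triangle x m (g • x)
  have a := hT.iso g m x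
  rw [m2, T.symm m x] at a
  omega

end Action
end TreeMetric

namespace SimpleGraph.IsTree

variable {V : Type*} {Γ : SimpleGraph V}

lemma closer_unique (hΓ : Γ.IsTree) {x y a b : V} (ha : Γ.Adj x a) (hb : Γ.Adj x b)
    (da : Γ.dist a y < Γ.dist x y) (db : Γ.dist b y < Γ.dist x y) : a = b := by
  have key : ∀ {a : V} (h : Γ.Adj x a), Γ.dist a y < Γ.dist x y →
      ∃ p : Γ.Walk a y, (SimpleGraph.Walk.cons h p).IsPath := by
    intro a h hd
    obtain ⟨p, hp⟩ := hΓ.connected.exists_walk_length_eq_dist a y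
    refine ⟨p, SimpleGraph.Walk.isPath_of_length_eq_dist _ ?_⟩
    have := SimpleGraph.dist_le (SimpleGraph.Walk.cons h p)
    simp only [SimpleGraph.Walk.length_cons] at this ⊢
    omega
  obtain ⟨p, hp⟩ := key ha da
  obtain ⟨q, hq⟩ := key hb db
  have e := (hΓ.isAcyclic.subsingleton_path x y).elim ⟨_, hp⟩ ⟨_, hq⟩
  have e' := congrArg Subtype.val e
  simp only [SimpleGraph.Walk.cons.injEq] at e'
  exact e'.1

lemma exists_closer (hΓ : Γ.IsTree) {x y : V} (h : x ≠ y) :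
    ∃ a, Γ.Adj x a ∧ Γ.dist a y + 1 = Γ.dist x y := by
  obtain ⟨p, hp⟩ := hΓ.connected.exists_walk_length_eq_dist x y
  cases p with
  | nil => exact absurd rfl h
  | @cons _ a _ hadj q =>
    refine ⟨a, hadj, ?_⟩
    have h1 := SimpleGraph.dist_le q
    have h2 := hΓ.connected.dist_triangle (u := x) (v := a) (w := y)
    rw [SimpleGraph.dist_eq_one_iff_adj.2 hadj] at h2
    simp only [SimpleGraph.Walk.length_cons] at hp
    omega

lemma dist_step (hΓ : Γ.IsTree) {x a : V} (y : V) (ha : Γ.Adj x a) :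
    Γ.dist a y + 1 = Γ.dist x y ∨ Γ.dist x y + 1 = Γ.dist a y := by
  have h1 := hΓ.dist_ne_of_adj y ha
  have h2 := hΓ.connected.dist_triangle (u := x) (v := a) (w := y)
  have h3 := hΓ.connected.dist_triangle (u := a) (v := x) (w := y)
  rw [SimpleGraph.dist_eq_one_iff_adj.2 ha] at h2
  rw [SimpleGraph.dist_eq_one_iff_adj.2 ha.symm] at h3
  rw [SimpleGraph.dist_comm, SimpleGraph.dist_comm (u := y)] at h1
  omega

lemma dist_eq_add (hΓ : Γ.IsTree) {y z : V} : ∀ (n : ℕ) {x a : V}, Γ.dist x z = n → Γ.Adj x a →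
    Γ.dist a z < Γ.dist x z → Γ.dist x y < Γ.dist a y →
    Γ.dist y z = Γ.dist x y + Γ.dist x z := by
  intro n
  induction n with
  | zero => intro x a h0 _ h; omega
  | succ n ih =>
    intro x a hn hxa h1 h2
    have s1 := hΓ.dist_step z hxa
    have s2 := hΓ.dist_step y hxa
    by_cases haz : a = z
    · subst haz
      rw [SimpleGraph.dist_self] at s1
      rw [SimpleGraph.dist_comm]
      omega
    · obtain ⟨b, hab, hb⟩ := hΓ.exists_closer haz
      have hbx : b ≠ x := by rintro rfl; omega
      have s3 := hΓ.dist_step y hab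
      have : Γ.dist a y < Γ.dist b y := by
        by_contra hlt
        exact hbx (hΓ.closer_unique hab hxa.symm (by omega) h2)
      have := ih (x := a) (by omega) hab (by omega) this
      omega

/-- The path metric of a tree. -/
noncomputable def treeMetric (hΓ : Γ.IsTree) : TreeMetric V where
  d := Γ.dist
  eq_of_d h := hΓ.connected.dist_eq_zero_iff.1 h
  d_self x := SimpleGraph.dist_self
  symm x y := SimpleGraph.dist_comm
  four := by
    intro x y z w
    induction hn : Γ.dist x y + Γ.dist x z + Γ.dist x w using Nat.strong_induction_on
      generalizing x with
    | _ n ih =>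
      have tr := fun u v w => hΓ.connected.dist_triangle (u := u) (v := v) (w := w)
      have sy := fun u v => Γ.dist_comm (u := u) (v := v)
      by_cases hxy : x = y
      · subst hxy
        have := tr z x w
        have := sy z x
        rw [SimpleGraph.dist_self]
        omega
      by_cases hxz : x = z
      · subst hxz
        have := sy x y
        omega
      by_cases hxw : x = w
      · subst hxw
        have := sy z x
        have := sy y x
        have := sy y z
        omega
      obtain ⟨a, ha, ha'⟩ := hΓ.exists_closer hxy
      have s1 := hΓ.dist_step z ha
      have s2 := hΓ.dist_step w ha
      have s3 := sy y z
      have s4 := sy y w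
      have t1 := tr y x z
      have t2 := tr y x w
      have t3 := tr z x w
      have s5 := sy y x
      have s6 := sy z x
      obtain ⟨b, hb, hb'⟩ := hΓ.exists_closer hxz
      have u1 := hΓ.dist_step w hb
      rcases s1 with s1 | s1
      · rcases s2 with s2 | s2
        · have := ih _ (by omega) a rfl
          omega
        · have := hΓ.dist_eq_add (y := w) (z := y) _ rfl ha (by omega) (by omega)
          have := hΓ.dist_eq_add (y := w) (z := z) _ rfl ha (by omega) (by omega)
          have := sy w y
          have := sy w z
          omega
      · have := hΓ.dist_eq_add (y := z) (z := y) _ rfl ha (by omega) (by omega)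
        rcases s2 with s2 | s2
        · have := hΓ.dist_eq_add (y := z) (z := w) _ rfl ha (by omega) (by omega)
          omega
        · have := hΓ.dist_eq_add (y := w) (z := y) _ rfl ha (by omega) (by omega)
          have := sy w y
          omega
  parity x y z := by
    induction hn : Γ.dist x z using Nat.strong_induction_on generalizing x with
    | _ n ih =>
      subst hn
      by_cases hxz : x = z
      · subst hxz
        simp [SimpleGraph.dist_comm (u := y)]
      · obtain ⟨a, ha, ha'⟩ := hΓ.exists_closer hxz
        have := ih _ (by omega) a rfl
        have s := hΓ.dist_step y ha
        rw [Nat.even_iff] at this ⊢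
        omega
  geod := by
    intro x y k
    induction k generalizing x with
    | zero => exact fun _ => ⟨x, by simp⟩
    | succ k ih =>
      intro hk
      have hxy : x ≠ y := by rintro rfl; simp at hk
      obtain ⟨a, ha, ha'⟩ := hΓ.exists_closer hxy
      obtain ⟨z, h1, h2⟩ := ih a (by omega)
      refine ⟨z, ?_⟩
      have h3 := hΓ.connected.dist_triangle (u := x) (v := a) (w := z)
      have h4 := hΓ.connected.dist_triangle (u := x) (v := z) (w := y)
      rw [SimpleGraph.dist_eq_one_iff_adj.2 ha] at h3
      omega

end SimpleGraph.IsTree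

/-- `AltWord S s t g` says that `g` is a nonempty product of elements taken alternately from
`S true \ S false` and `S false \ S true`, the first from `S s` and the last from `S t`. -/
inductive AltWord {G : Type*} [Group G] (S : Bool → Subgroup G) : Bool → Bool → G → Prop
  | single {s : Bool} {g : G} (h : g ∈ S s) (h' : g ∉ S (!s)) : AltWord S s s g
  | snoc {s t : Bool} {g x : G} (hg : AltWord S s t g) (h : x ∈ S (!t)) (h' : x ∉ S t) :
      AltWord S s (!t) (g * x)

namespace AltWord

variable {G : Type*} [Group G] {S : Bool → Subgroup G}

lemma append {s t t' : Bool} {g h : G} (hg : AltWord S s t g) (hh : AltWord S (!t) t' h) :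
    AltWord S s t' (g * h) := by
  induction hh with
  | single h h' => exact hg.snoc h (by simpa using h')
  | snoc _ h h' ih => rw [← mul_assoc]; exact ih.snoc h h'

lemma inv {s t : Bool} {g : G} (hg : AltWord S s t g) : AltWord S t s g⁻¹ := by
  induction hg with
  | single h h' => exact single (inv_mem h) (by simpa using h')
  | @snoc t g x _ h h' ih =>
    rw [mul_inv_rev]
    exact (single (s := !t) (inv_mem h) (by simpa using h')).append (by simpa using ih)

lemma mono {H : Type*} [Group H] {S' : Bool → Subgroup H} (f : H →* G)
    (h : ∀ s x, x ∈ S' s → x ∉ S' (!s) → f x ∈ S s ∧ f x ∉ S (!s)) {s t : Bool} {g : H}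
    (hg : AltWord S' s t g) : AltWord S s t (f g) := by
  induction hg with
  | single h1 h2 => exact single (h _ _ h1 h2).1 (h _ _ h1 h2).2
  | @snoc t g x _ h1 h2 ih =>
    have := h (!t) x h1 (by simpa using h2)
    rw [map_mul]
    exact ih.snoc this.1 (by simpa using this.2)

lemma mul_base {s t : Bool} {g c : G} (hg : AltWord S s t g) (hc : ∀ u, c ∈ S u) :
    AltWord S s t (g * c) := by
  cases hg with
  | single h h' =>
    exact single (mul_mem h (hc _)) fun h2 => h' ((Subgroup.mul_mem_cancel_right _ (hc _)).1 h2)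
  | snoc hg h h' =>
    rw [mul_assoc]
    exact hg.snoc (mul_mem h (hc _)) fun h2 => h' ((Subgroup.mul_mem_cancel_right _ (hc _)).1 h2)

lemma mul_mem' {s t u : Bool} {g x : G} (hg : AltWord S s t g) (hx : x ∈ S u) :
    (∃ t', AltWord S s t' (g * x)) ∨ ∀ v, g * x ∈ S v := by
  by_cases hc : ∀ v, x ∈ S v
  · exact Or.inl ⟨_, hg.mul_base hc⟩
  have hx' : x ∉ S (!u) := by
    intro h; apply hc; intro v
    cases u <;> cases v <;> assumption
  by_cases hu : u = !t
  · subst hu; exact Or.inl ⟨_, hg.snoc hx (by simpa using hx')⟩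
  have hu' : u = t := by cases u <;> cases t <;> simp_all
  rw [hu'] at hx hx' hu
  clear hu' hu
  cases hg with
  | single h h' =>
    by_cases h2 : g * x ∈ S (!s)
    · right; intro v
      have h1 := mul_mem h hx
      cases s <;> cases v <;> assumption
    · exact Or.inl ⟨_, single (mul_mem h hx) h2⟩
  | @snoc t g y hg h h' =>
    rw [mul_assoc]
    have h1 := mul_mem h hx
    by_cases h2 : y * x ∈ S t
    · refine Or.inl ⟨_, hg.mul_base fun v => ?_⟩
      cases t <;> cases v <;> assumption
    · exact Or.inl ⟨_, hg.snoc h1 h2⟩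

lemma cases_of_top (htop : ∀ T : Subgroup G, S true ≤ T → S false ≤ T → T = ⊤) (g : G) :
    (∀ u, g ∈ S u) ∨ ∃ s t, AltWord S s t g := by
  let P : Subgroup G :=
    { carrier := {g | ∀ h, ((∀ u, h ∈ S u) ∨ ∃ s t, AltWord S s t h) →
        ((∀ u, h * g ∈ S u) ∨ ∃ s t, AltWord S s t (h * g))} ∩
        {g | ∀ h, ((∀ u, h ∈ S u) ∨ ∃ s t, AltWord S s t h) →
        ((∀ u, h * g⁻¹ ∈ S u) ∨ ∃ s t, AltWord S s t (h * g⁻¹))}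
      one_mem' := by simp
      mul_mem' := by
        rintro a b ⟨h1, h2⟩ ⟨h3, h4⟩
        constructor
        · intro h hh
          rw [← mul_assoc]; exact h3 _ (h1 _ hh)
        · intro h hh
          rw [mul_inv_rev, ← mul_assoc]; exact h2 _ (h4 _ hh)
      inv_mem' := by
        rintro a ⟨h1, h2⟩
        exact ⟨h2, by simpa using h1⟩ }
  have key : ∀ u, ∀ x ∈ S u, ∀ h, ((∀ u, h ∈ S u) ∨ ∃ s t, AltWord S s t h) →
        ((∀ u, h * x ∈ S u) ∨ ∃ s t, AltWord S s t (h * x)) := by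
    rintro u x hx h (hh | ⟨s, t, hh⟩)
    · by_cases hx' : x ∈ S (!u)
      · left; intro v
        refine mul_mem (hh v) ?_
        cases u <;> cases v <;> assumption
      · exact Or.inr ⟨u, u, AltWord.single (mul_mem (hh u) hx) fun h' =>
          hx' ((Subgroup.mul_mem_cancel_left _ (hh _)).1 h')⟩
    · rcases hh.mul_mem' hx with ⟨t', h'⟩ | h'
      · exact Or.inr ⟨_, _, h'⟩
      · exact Or.inl h'
  have hP : P = ⊤ := htop P (fun x hx => ⟨key _ x hx, key _ _ (inv_mem hx)⟩)
    (fun x hx => ⟨key _ x hx, key _ _ (inv_mem hx)⟩)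
  have : g ∈ P := hP ▸ Subgroup.mem_top g
  simpa using this.1 1 (Or.inl fun u => one_mem _)

end AltWord

/-- `G` is the internal amalgamated product of its subgroups `S true` and `S false`. -/
structure IsAmalgam {G : Type*} [Group G] (S : Bool → Subgroup G) : Prop where
  top : ∀ T : Subgroup G, S true ≤ T → S false ≤ T → T = ⊤
  ne_one : ∀ {s t g}, AltWord S s t g → g ≠ 1

namespace IsAmalgam

variable {G : Type*} [Group G] {S : Bool → Subgroup G}

lemma not_mem_base (hS : IsAmalgam S) {s t : Bool} {g : G} (hg : AltWord S s t g) :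
    ¬ ∀ u, g ∈ S u := fun h =>
  hS.ne_one (hg.mul_base fun u => inv_mem (h u)) (mul_inv_cancel g)

lemma first_eq (hS : IsAmalgam S) {s t s' t' : Bool} {g : G} (h : AltWord S s t g)
    (h' : AltWord S s' t' g) : s = s' := by
  by_contra hne
  have : s' = !s := by cases s <;> cases s' <;> simp_all
  subst this
  exact hS.ne_one (h.inv.append h') (inv_mul_cancel g)

lemma eq_of_mem (hS : IsAmalgam S) {s t u : Bool} {g : G} (h : AltWord S s t g)
    (hg : g ∈ S u) : s = u := by
  refine hS.first_eq h (AltWord.single hg fun h' => hS.not_mem_base h fun v => ?_)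
  cases u <;> cases v <;> assumption

lemma cases_word (hS : IsAmalgam S) (g : G) :
    (∀ u, g ∈ S u) ∨ ∃ s t, AltWord S s t g :=
  AltWord.cases_of_top hS.top g

variable (S) in
/-- Vertices of the Bass-Serre tree. -/
abbrev BSVertex : Type _ := (G ⧸ S true) ⊕ (G ⧸ S false)

variable (S) in
/-- The Bass-Serre tree. -/
def bsGraph : SimpleGraph (BSVertex S) where
  Adj v w := ∃ g : G, (v = Sum.inl (g : G ⧸ S true) ∧ w = Sum.inr (g : G ⧸ S false)) ∨
    (w = Sum.inl (g : G ⧸ S true) ∧ v = Sum.inr (g : G ⧸ S false))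
  symm := ⟨by
    rintro v w ⟨g, h | h⟩
    · exact ⟨g, Or.inr h⟩
    · exact ⟨g, Or.inl h⟩⟩
  loopless := ⟨by rintro v ⟨g, ⟨h1, h2⟩ | ⟨h1, h2⟩⟩ <;> simp [h1] at h2⟩

lemma adj_smul {v w : BSVertex S} (k : G) (h : (bsGraph S).Adj v w) :
    (bsGraph S).Adj (k • v) (k • w) := by
  obtain ⟨g, ⟨rfl, rfl⟩ | ⟨rfl, rfl⟩⟩ := h
  · exact ⟨k * g, Or.inl ⟨rfl, rfl⟩⟩
  · exact ⟨k * g, Or.inr ⟨rfl, rfl⟩⟩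

lemma reachable_smul {v w : BSVertex S} (k : G) (h : (bsGraph S).Reachable v w) :
    (bsGraph S).Reachable (k • v) (k • w) := by
  obtain ⟨p⟩ := h
  induction p with
  | nil => exact SimpleGraph.Reachable.refl _
  | cons h _ ih => exact (adj_smul k h).reachable.trans ih

lemma bsGraph_connected (hS : IsAmalgam S) : (bsGraph S).Connected := by
  let v : BSVertex S := Sum.inl ((1 : G) : G ⧸ S true)
  have adj : ∀ g : G, (bsGraph S).Adj (Sum.inl (g : G ⧸ S true)) (Sum.inr (g : G ⧸ S false)) :=
    fun g => ⟨g, Or.inl ⟨rfl, rfl⟩⟩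
  let P : Subgroup G :=
    { carrier := {g | (bsGraph S).Reachable v (g • v)}
      one_mem' := by simp
      mul_mem' := by
        intro a b ha hb
        have := reachable_smul a hb
        rw [← mul_smul] at this
        exact ha.trans this
      inv_mem' := by
        intro a ha
        have := reachable_smul a⁻¹ ha
        rw [inv_smul_smul] at this
        exact this.symm }
  have hP : P = ⊤ := by
    apply hS.top
    · intro a ha
      change (bsGraph S).Reachable v (Sum.inl ((a * 1 : G) : G ⧸ S true))
      rw [mul_one, show ((a : G) : G ⧸ S true) = ((1 : G) : G ⧸ S true) from
        QuotientGroup.eq.2 (by simpa using ha)]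
    · intro b hb
      change (bsGraph S).Reachable v (Sum.inl ((b * 1 : G) : G ⧸ S true))
      rw [mul_one]
      have h1 := (adj 1).reachable
      have h2 := (adj b).reachable
      rw [show ((b : G) : G ⧸ S false) = ((1 : G) : G ⧸ S false) from
        QuotientGroup.eq.2 (by simpa using hb)] at h2
      exact h1.trans h2.symm
  have key : ∀ w, (bsGraph S).Reachable v w := by
    have : ∀ g : G, (bsGraph S).Reachable v (Sum.inl (g : G ⧸ S true)) := by
      intro g
      have : g ∈ P := hP ▸ Subgroup.mem_top g
      have : (bsGraph S).Reachable v (Sum.inl ((g * 1 : G) : G ⧸ S true)) := this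
      rwa [mul_one] at this
    rintro (w | w) <;> induction w using QuotientGroup.induction_on with
    | H g => first | exact this g | exact (this g).trans (adj g).reachable
  have : Nonempty (BSVertex S) := ⟨v⟩
  exact ⟨fun x y => (key x).symm.trans (key y)⟩

lemma word_mul (hS : IsAmalgam S) {s t : Bool} {g x : G} (hg : AltWord S (!s) t g)
    (hx : x ∈ S s) : ∃ t', AltWord S (!s) t' (g * x) := by
  rcases hg.mul_mem' hx with h | h
  · exact h
  · have := hS.eq_of_mem hg (u := s) (by simpa using mul_mem (h s) (inv_mem hx))
    simp at this

/-- The side of the base edge on which a vertex lies. -/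
noncomputable def side (hS : IsAmalgam S) : BSVertex S → Prop
  | Sum.inl v => Quotient.lift (fun g : G => ¬ ∃ t, AltWord S false t g) (by
      intro a b hab
      have hab : a⁻¹ * b ∈ S true := QuotientGroup.leftRel_apply.1 hab
      simp only [eq_iff_iff, not_iff_not]
      constructor
      · rintro ⟨t, h⟩
        have := hS.word_mul (s := true) h hab
        simpa using this
      · rintro ⟨t, h⟩
        have := hS.word_mul (s := true) h (inv_mem hab)
        simpa using this) v
  | Sum.inr v => Quotient.lift (fun g : G => ∃ t, AltWord S true t g) (by
      intro a b hab
      have hab : a⁻¹ * b ∈ S false := QuotientGroup.leftRel_apply.1 hab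
      simp only [eq_iff_iff]
      constructor
      · rintro ⟨t, h⟩
        have := hS.word_mul (s := false) h hab
        simpa using this
      · rintro ⟨t, h⟩
        have := hS.word_mul (s := false) h (inv_mem hab)
        simpa using this) v

lemma side_eq (hS : IsAmalgam S) {g : G} (hg : ¬ ∀ u, g ∈ S u) :
    hS.side (Sum.inl (g : G ⧸ S true)) ↔ hS.side (Sum.inr (g : G ⧸ S false)) := by
  change (¬ ∃ t, AltWord S false t g) ↔ ∃ t, AltWord S true t g
  rcases hS.cases_word g with h | ⟨s, t, h⟩
  · exact absurd h hg
  · constructor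
    · intro h'
      cases s
      · exact absurd ⟨t, h⟩ h'
      · exact ⟨t, h⟩
    · rintro ⟨t, h⟩ ⟨t', h'⟩
      have := hS.first_eq h h'
      simp at this

lemma bridge_one (hS : IsAmalgam S) : (bsGraph S).IsBridge
    s(Sum.inl ((1 : G) : G ⧸ S true), Sum.inr ((1 : G) : G ⧸ S false)) := by
  rw [SimpleGraph.isBridge_iff]
  intro hr
  have inv : ∀ v w, ((bsGraph S) \ SimpleGraph.fromEdgeSet {s(Sum.inl ((1 : G) : G ⧸ S true),
      Sum.inr ((1 : G) : G ⧸ S false))}).Reachable v w → (hS.side v ↔ hS.side w) := by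
    rintro v w ⟨p⟩
    induction p with
    | nil => rfl
    | @cons a b c h _ ih =>
      rw [← ih]
      rw [SimpleGraph.sdiff_adj] at h
      obtain ⟨⟨g, hg⟩, h2⟩ := h
      have hC : ¬ ∀ u, g ∈ S u := by
        intro hC
        apply h2
        have e1 : (g : G ⧸ S true) = ((1 : G) : G ⧸ S true) :=
          QuotientGroup.eq.2 (by simpa using hC _)
        have e2 : (g : G ⧸ S false) = ((1 : G) : G ⧸ S false) :=
          QuotientGroup.eq.2 (by simpa using hC _)
        rw [e1, e2] at hg
        rcases hg with ⟨rfl, rfl⟩ | ⟨rfl, rfl⟩ <;> simp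
      rcases hg with ⟨rfl, rfl⟩ | ⟨rfl, rfl⟩
      · exact hS.side_eq hC
      · exact (hS.side_eq hC).symm
  have h1 : hS.side (Sum.inl ((1 : G) : G ⧸ S true)) := by
    rintro ⟨t, h⟩
    exact hS.ne_one h rfl
  obtain ⟨t, h⟩ := (inv _ _ hr).1 h1
  exact hS.ne_one h rfl

lemma bsGraph_isTree (hS : IsAmalgam S) : (bsGraph S).IsTree := by
  refine ⟨hS.bsGraph_connected, SimpleGraph.isAcyclic_iff_forall_adj_isBridge.2 ?_⟩
  have key : ∀ g : G, (bsGraph S).IsBridge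
      s(Sum.inl (g : G ⧸ S true), Sum.inr (g : G ⧸ S false)) := by
    intro g
    have h1 := hS.bridge_one
    rw [SimpleGraph.isBridge_iff] at h1 ⊢
    intro hr
    apply h1
    have inv : ∀ v w, ((bsGraph S) \ SimpleGraph.fromEdgeSet {s(Sum.inl (g : G ⧸ S true),
        Sum.inr (g : G ⧸ S false))}).Reachable v w →
        ((bsGraph S) \ SimpleGraph.fromEdgeSet {s(Sum.inl ((1 : G) : G ⧸ S true),
        Sum.inr ((1 : G) : G ⧸ S false))}).Reachable (g⁻¹ • v) (g⁻¹ • w) := by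
      rintro v w ⟨p⟩
      induction p with
      | nil => exact SimpleGraph.Reachable.refl _
      | @cons a b c h _ ih =>
        refine SimpleGraph.Reachable.trans (SimpleGraph.Adj.reachable ?_) ih
        rw [SimpleGraph.sdiff_adj] at h ⊢
        refine ⟨adj_smul _ h.1, fun h' => h.2 ?_⟩
        rw [SimpleGraph.fromEdgeSet_adj] at h' ⊢
        refine ⟨?_, fun e => h'.2 (by rw [e])⟩
        have h3 := h'.1
        simp only [Set.mem_singleton_iff, Sym2.eq_iff, inv_smul_eq_iff] at h3 ⊢
        have e1 : g • (Sum.inl ((1 : G) : G ⧸ S true) : BSVertex S) = Sum.inl (g : G ⧸ S true) := by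
          change Sum.inl ((g * 1 : G) : G ⧸ S true) = _
          rw [mul_one]
        have e2 : g • (Sum.inr ((1 : G) : G ⧸ S false) : BSVertex S) =
            Sum.inr (g : G ⧸ S false) := by
          change Sum.inr ((g * 1 : G) : G ⧸ S false) = _
          rw [mul_one]
        rwa [e1, e2] at h3
    have := inv _ _ hr
    have e1 : g⁻¹ • (Sum.inl (g : G ⧸ S true) : BSVertex S) = Sum.inl ((1 : G) : G ⧸ S true) := by
      change Sum.inl ((g⁻¹ * g : G) : G ⧸ S true) = _
      rw [inv_mul_cancel]
    have e2 : g⁻¹ • (Sum.inr (g : G ⧸ S false) : BSVertex S) = Sum.inr ((1 : G) : G ⧸ S false) := by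
      change Sum.inr ((g⁻¹ * g : G) : G ⧸ S false) = _
      rw [inv_mul_cancel]
    rwa [e1, e2] at this
  rintro v w ⟨g, ⟨rfl, rfl⟩ | ⟨rfl, rfl⟩⟩
  · exact key g
  · rw [Sym2.eq_swap]; exact key g

end IsAmalgam

/-- `G` has no involutions and its subgroups are cyclic, embed in `BS12` or contain a free group. -/
structure TitsAlt (G : Type) [Group G] : Prop where
  no_invol : ∀ g : G, g * g = 1 → g = 1
  alt : ∀ (H : Type) [Group H] (f : H →* G), Function.Injective f →
    IsCyclic H ∨ (∃ f : H →* BS12, Function.Injective f) ∨ HasFreeSubgroup H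

lemma TitsAlt.of_injective {G H : Type} [Group G] [Group H] (hG : TitsAlt G) (f : H →* G)
    (hf : Function.Injective f) : TitsAlt H where
  no_invol g hg := hf (by rw [map_one]; exact hG.no_invol _ (by rw [← map_mul, hg, map_one]))
  alt K _ k hk := hG.alt K (f.comp k) (hf.comp hk)

namespace IsAmalgam

variable {G : Type*} [Group G] {S : Bool → Subgroup G}

lemma fix_inl {g k : G} : g • (Sum.inl (k : G ⧸ S true) : BSVertex S) = Sum.inl (k : G ⧸ S true) ↔
    k⁻¹ * g * k ∈ S true := by
  change (Sum.inl ((g * k : G) : G ⧸ S true) : BSVertex S) = _ ↔ _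
  rw [Sum.inl.injEq, eq_comm, QuotientGroup.eq, mul_assoc]

lemma fix_inr {g k : G} : g • (Sum.inr (k : G ⧸ S false) : BSVertex S) =
    Sum.inr (k : G ⧸ S false) ↔ k⁻¹ * g * k ∈ S false := by
  change (Sum.inr ((g * k : G) : G ⧸ S false) : BSVertex S) = _ ↔ _
  rw [Sum.inr.injEq, eq_comm, QuotientGroup.eq, mul_assoc]

/-- The metric of the Bass-Serre tree. -/
noncomputable def metric (hS : IsAmalgam S) : TreeMetric (BSVertex S) := hS.bsGraph_isTree.treeMetric

lemma metric_eq_one (hS : IsAmalgam S) {v w : BSVertex S} :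
    hS.metric.d v w = 1 ↔ (bsGraph S).Adj v w := SimpleGraph.dist_eq_one_iff_adj

lemma dist_parity (hS : IsAmalgam S) (v w : BSVertex S) :
    Even (hS.metric.d v w) ↔ (v.isLeft = w.isLeft) := by
  obtain ⟨p, hp⟩ := hS.bsGraph_connected.exists_walk_length_eq_dist v w
  change Even ((bsGraph S).dist v w) ↔ _
  rw [← hp]
  clear hp
  induction p with
  | nil => simp
  | cons h p ih =>
    rw [SimpleGraph.Walk.length_cons, Nat.even_add_one, ih]
    obtain ⟨g, ⟨rfl, rfl⟩ | ⟨rfl, rfl⟩⟩ := h <;> simp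

lemma isLeft_smul (g : G) (v : BSVertex S) : (g • v).isLeft = v.isLeft := by
  cases v <;> rfl

lemma acts (hS : IsAmalgam S) : hS.metric.Acts G where
  iso g x y := by
    have key : ∀ (g : G) x y, hS.metric.d (g • x) (g • y) ≤ hS.metric.d x y := by
      intro g x y
      obtain ⟨p, hp⟩ := hS.bsGraph_connected.exists_walk_length_eq_dist x y
      change (bsGraph S).dist _ _ ≤ (bsGraph S).dist _ _
      rw [← hp]
      clear hp
      induction p with
      | nil => simp
      | @cons a b c h p ih =>
        have := hS.bsGraph_connected.dist_triangle (u := g • a) (v := g • b) (w := g • c)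
        refine this.trans ?_
        rw [SimpleGraph.Walk.length_cons, SimpleGraph.dist_eq_one_iff_adj.2 (adj_smul g h)]
        omega
    refine le_antisymm (key g x y) ?_
    have := key g⁻¹ (g • x) (g • y)
    rwa [inv_smul_smul, inv_smul_smul] at this
  even g x := by rw [dist_parity, isLeft_smul]

lemma eq_one_of_path (hac : ∀ a b g : G, a ∈ S true → a ∉ S false → b ∈ S false → b ∉ S true →
      g ∈ S true → g ∈ S false → a⁻¹ * g * a ∈ S false → b⁻¹ * g * b ∈ S true → g = 1)
    {v w : BSVertex S} {g k : G}
    (h1 : (bsGraph S).Adj (Sum.inl (k : G ⧸ S true)) v) (hv : v ≠ Sum.inr (k : G ⧸ S false))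
    (h2 : (bsGraph S).Adj (Sum.inr (k : G ⧸ S false)) w) (hw : w ≠ Sum.inl (k : G ⧸ S true))
    (g1 : g • v = v) (g2 : g • w = w)
    (g3 : g • (Sum.inl (k : G ⧸ S true) : BSVertex S) = Sum.inl (k : G ⧸ S true))
    (g4 : g • (Sum.inr (k : G ⧸ S false) : BSVertex S) = Sum.inr (k : G ⧸ S false)) :
    g = 1 := by
  obtain ⟨x, ⟨e1, rfl⟩ | ⟨rfl, e1⟩⟩ := h1
  swap
  · simp at e1
  obtain ⟨y, ⟨e2, rfl⟩ | ⟨rfl, e2⟩⟩ := h2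
  · simp at e2
  rw [Sum.inl.injEq, QuotientGroup.eq] at e1
  rw [Sum.inr.injEq, QuotientGroup.eq] at e2
  rw [Ne, Sum.inr.injEq, eq_comm, QuotientGroup.eq] at hv
  rw [Ne, Sum.inl.injEq, eq_comm, QuotientGroup.eq] at hw
  rw [fix_inl] at g2 g3
  rw [fix_inr] at g1 g4
  have := hac (k⁻¹ * x) (k⁻¹ * y) (k⁻¹ * g * k) e1 hv e2 hw g3 g4
    (by simpa [mul_assoc] using g1) (by simpa [mul_assoc] using g2)
  rw [mul_assoc, inv_mul_eq_one] at this
  simpa using this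

lemma acylindrical (hS : IsAmalgam S)
    (hac : ∀ a b g : G, a ∈ S true → a ∉ S false → b ∈ S false → b ∉ S true →
      g ∈ S true → g ∈ S false → a⁻¹ * g * a ∈ S false → b⁻¹ * g * b ∈ S true → g = 1) :
    hS.metric.Acylindrical G := by
  intro g x y hx hy hd
  obtain ⟨x₃, d3, d3'⟩ := hS.metric.geod x y 3 hd
  have f3 := TreeMetric.fixed_of_between hS.acts hx hy d3'
  obtain ⟨x₂, d2, d2'⟩ := hS.metric.geod x x₃ 2 (by omega)
  have f2 := TreeMetric.fixed_of_between hS.acts hx f3 d2'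
  obtain ⟨x₁, d1, d1'⟩ := hS.metric.geod x x₂ 1 (by omega)
  have f1 := TreeMetric.fixed_of_between hS.acts hx f2 d1'
  have n1 : x₂ ≠ x := by rintro rfl; rw [hS.metric.d_self] at d2; omega
  have n2 : x₁ ≠ x₃ := by rintro rfl; omega
  have a1 : (bsGraph S).Adj x x₁ := hS.metric_eq_one.1 d1
  have a2 : (bsGraph S).Adj x₁ x₂ := hS.metric_eq_one.1 (by omega)
  have a3 : (bsGraph S).Adj x₂ x₃ := hS.metric_eq_one.1 (by omega)
  obtain ⟨k, ⟨rfl, rfl⟩ | ⟨rfl, rfl⟩⟩ := a2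
  · exact eq_one_of_path hac a1.symm n1.symm a3 n2.symm hx f3 f1 f2
  · exact eq_one_of_path hac a3 n2.symm a1.symm n1.symm f3 hx f2 f1

lemma conj_mem_of_fixed {g : G} {v : BSVertex S} (h : g • v = v) :
    ∃ (k : G) (u : Bool), k⁻¹ * g * k ∈ S u := by
  rcases v with v | v <;> induction v using QuotientGroup.induction_on with
  | H k => first | exact ⟨k, _, fix_inl.1 h⟩ | exact ⟨k, _, fix_inr.1 h⟩

theorem titsAlt {G : Type} [Group G] {S : Bool → Subgroup G} (hS : IsAmalgam S)
    (hac : ∀ a b g : G, a ∈ S true → a ∉ S false → b ∈ S false → b ∉ S true →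
      g ∈ S true → g ∈ S false → a⁻¹ * g * a ∈ S false → b⁻¹ * g * b ∈ S true → g = 1)
    (ht : ∀ u, TitsAlt (S u)) : TitsAlt G := by
  have : Nonempty (BSVertex S) := ⟨Sum.inl ((1 : G) : G ⧸ S true)⟩
  have h2 : ∀ g : G, g * g = 1 → g = 1 := by
    intro g hg
    have : ∃ v : BSVertex S, g • v = v := by
      by_contra! hne
      obtain ⟨x, hx⟩ := TreeMetric.exists_hyp hS.acts hne
      exact hx.ne_one hS.acts two_ne_zero (by rw [pow_two, hg])
    obtain ⟨v, hv⟩ := this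
    obtain ⟨k, u, hk⟩ := conj_mem_of_fixed hv
    have := (ht u).no_invol ⟨_, hk⟩ (Subtype.ext (by
      change k⁻¹ * g * k * (k⁻¹ * g * k) = 1
      calc k⁻¹ * g * k * (k⁻¹ * g * k) = k⁻¹ * (g * g) * k := by group
        _ = 1 := by rw [hg]; group))
    have := congrArg Subtype.val this
    change k⁻¹ * g * k = 1 at this
    rw [mul_assoc, inv_mul_eq_one] at this
    simpa using this
  refine ⟨h2, fun H _ f hf => ?_⟩
  let _ : MulAction H (BSVertex S) := MulAction.compHom _ f
  have hT : hS.metric.Acts H := ⟨fun h => hS.acts.iso (f h), fun h => hS.acts.even (f h)⟩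
  have hA : hS.metric.Acylindrical H := fun h x y hx hy hd =>
    hf (by rw [map_one]; exact hS.acylindrical hac (f h) x y hx hy hd)
  rcases TreeMetric.acylindrical_alternative hT hA fun h hh => hf (by
    rw [map_one]; exact h2 _ (by rw [← map_mul, hh, map_one])) with ⟨v, hv⟩ | h | h
  · have : ∃ (k : G) (u : Bool), ∀ h, k⁻¹ * f h * k ∈ S u := by
      rcases v with v | v <;> induction v using QuotientGroup.induction_on with
      | H k => first | exact ⟨k, _, fun h => fix_inl.1 (hv h)⟩ | exact ⟨k, _, fun h => fix_inr.1 (hv h)⟩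
    obtain ⟨k, u, hk⟩ := this
    let f' : H →* S u :=
      { toFun := fun h => ⟨_, hk h⟩
        map_one' := Subtype.ext (by simp)
        map_mul' := fun a b => Subtype.ext (by simp [mul_assoc]) }
    refine (ht u).alt H f' fun a b hab => hf ?_
    have := congrArg Subtype.val hab
    simpa [f'] using this
  · exact Or.inl h
  · exact Or.inr (Or.inr h)

end IsAmalgam

/-- A pair of subgroups as a family indexed by `Bool`. -/
def pairS {G : Type*} [Group G] (A B : Subgroup G) (u : Bool) : Subgroup G := cond u A B

section Family

open Monoid

variable {G C : Type} [Group G] [Group C] {F : Bool → Type} [∀ u, Group (F u)]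
  {φ : ∀ u, C →* F u} {i : ∀ u, F u →* G} {θ : G →* PushoutI φ}

lemma family_injective (hφ : ∀ u, Function.Injective (φ u))
    (hθ : ∀ u x, θ (i u x) = PushoutI.of u x) (u : Bool) : Function.Injective (i u) := by
  intro x y h
  apply PushoutI.of_injective hφ u
  rw [← hθ, ← hθ, h]

lemma family_inter (hφ : ∀ u, Function.Injective (φ u))
    (hθ : ∀ u x, θ (i u x) = PushoutI.of u x) {u : Bool} {x : F u} {y : F (!u)}
    (h : i u x = i (!u) y) : ∃ c, φ u c = x := by
  have h1 : PushoutI.of (φ := φ) u x ∈ (PushoutI.base φ).range := by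
    rw [← PushoutI.inf_of_range_eq_base_range hφ (i := u) (j := !u) (by cases u <;> simp)]
    refine ⟨⟨x, rfl⟩, ⟨y, ?_⟩⟩
    rw [← hθ, ← hθ, h]
  obtain ⟨c, hc⟩ := h1
  refine ⟨c, PushoutI.of_injective hφ u ?_⟩
  rw [← hc, PushoutI.of_apply_eq_base]

lemma family_word (hi : ∀ u c, i u (φ u c) = i (!u) (φ (!u) c))
    (hθ : ∀ u x, θ (i u x) = PushoutI.of u x) {s t : Bool} {g : G}
    (hg : AltWord (fun u => (i u).range) s t g) :
    ∃ w : CoprodI.Word F, w.fstIdx = some t ∧ PushoutI.Reduced φ w ∧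
      θ g⁻¹ = PushoutI.ofCoprodI w.prod := by
  have key : ∀ (u : Bool) (x : G), x ∈ (i u).range → x ∉ (i (!u)).range →
      ∃ a : F u, i u a = x⁻¹ ∧ a ∉ (φ u).range := by
    rintro u _ ⟨a, rfl⟩ h2
    refine ⟨a⁻¹, by simp, ?_⟩
    rintro ⟨c, hc⟩
    apply h2
    refine ⟨φ (!u) c⁻¹, ?_⟩
    rw [← hi, map_inv, hc, inv_inv]
  have ne : ∀ u (a : F u), a ∉ (φ u).range → a ≠ 1 := by
    rintro u a h rfl
    exact h (one_mem _)
  induction hg with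
  | @single g h h' =>
    obtain ⟨a, ha, ha'⟩ := key s g h h'
    refine ⟨CoprodI.Word.cons a CoprodI.Word.empty (by simp [CoprodI.Word.fstIdx]) (ne _ _ ha'),
      by simp, ?_, ?_⟩
    · rintro ⟨v, b⟩ hb
      simp only [CoprodI.Word.cons, CoprodI.Word.empty, List.mem_singleton, Sigma.mk.injEq] at hb
      obtain ⟨rfl, hb⟩ := hb
      rw [eq_of_heq hb]
      exact ha'
    · rw [CoprodI.Word.prod_cons, map_mul, PushoutI.ofCoprodI_of, ← ha, hθ]
      simp
  | @snoc t g x _ h h' ih =>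
    obtain ⟨a, ha, ha'⟩ := key (!t) x h (by rw [Bool.not_not]; exact h')
    obtain ⟨w, hw1, hw2, hw3⟩ := ih
    refine ⟨CoprodI.Word.cons a w (by rw [hw1]; simp) (ne _ _ ha'), by simp, ?_, ?_⟩
    · rintro ⟨v, b⟩ hb
      simp only [CoprodI.Word.cons, List.mem_cons, Sigma.mk.injEq] at hb
      rcases hb with ⟨rfl, hb⟩ | hb
      · rw [eq_of_heq hb]
        exact ha'
      · exact hw2 _ hb
    · rw [CoprodI.Word.prod_cons, map_mul, PushoutI.ofCoprodI_of, mul_inv_rev, map_mul, ← ha, hθ,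
        hw3]

lemma family_isAmalgam (hφ : ∀ u, Function.Injective (φ u))
    (hi : ∀ u c, i u (φ u c) = i (!u) (φ (!u) c))
    (hθ : ∀ u x, θ (i u x) = PushoutI.of u x)
    (hgen : ∀ T : Subgroup G, (i true).range ≤ T → (i false).range ≤ T → T = ⊤) :
    IsAmalgam (fun u => (i u).range) where
  top := hgen
  ne_one := by
    rintro s t _ hg rfl
    obtain ⟨w, h1, h2, h3⟩ := family_word hi hθ hg
    rw [inv_one, map_one] at h3
    have := h2.eq_empty_of_mem_range hφ (h3 ▸ one_mem _)
    subst this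
    simp [CoprodI.Word.fstIdx] at h1

end Family

/-- The data of a pushout of groups along injective maps. -/
structure AmalgamData (G A B C : Type) [Group G] [Group A] [Group B] [Group C] where
  φA : C →* A
  φB : C →* B
  iA : A →* G
  iB : B →* G
  injA : Function.Injective φA
  injB : Function.Injective φB
  comm : ∀ c, iA (φA c) = iB (φB c)
  gen : ∀ T : Subgroup G, iA.range ≤ T → iB.range ≤ T → T = ⊤
  desc : ∀ (P : Type) [Group P] (α : A →* P) (β : B →* P), (∀ c, α (φA c) = β (φB c)) →
    ∃ θ : G →* P, (∀ a, θ (iA a) = α a) ∧ ∀ b, θ (iB b) = β b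

namespace AmalgamData

variable {G A B C : Type} [Group G] [Group A] [Group B] [Group C] (D : AmalgamData G A B C)

/-- The two factors as a family. -/
def Fam (A B : Type) (u : Bool) : Type := cond u A B

instance (u : Bool) : Group (Fam A B u) :=
  match u with
  | true => inferInstanceAs (Group A)
  | false => inferInstanceAs (Group B)

/-- The maps from the base. -/
def famφ : ∀ u, C →* Fam A B u
  | true => D.φA
  | false => D.φB

/-- The maps to the pushout. -/
def fami : ∀ u, Fam A B u →* G
  | true => D.iA
  | false => D.iB

lemma famφ_injective : ∀ u, Function.Injective (D.famφ u)
  | true => D.injA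
  | false => D.injB

lemma exists_hom : ∃ θ : G →* Monoid.PushoutI D.famφ,
    ∀ u x, θ (D.fami u x) = Monoid.PushoutI.of u x := by
  obtain ⟨θ, h1, h2⟩ := D.desc (Monoid.PushoutI D.famφ) (Monoid.PushoutI.of (φ := D.famφ) true)
    (Monoid.PushoutI.of (φ := D.famφ) false) fun c =>
      (Monoid.PushoutI.of_apply_eq_base D.famφ true c).trans
        (Monoid.PushoutI.of_apply_eq_base D.famφ false c).symm
  refine ⟨θ, ?_⟩
  rintro (_ | _) x
  · exact h2 x
  · exact h1 x

lemma iA_injective : Function.Injective D.iA := by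
  obtain ⟨θ, h⟩ := D.exists_hom
  exact family_injective D.famφ_injective h true

lemma iB_injective : Function.Injective D.iB := by
  obtain ⟨θ, h⟩ := D.exists_hom
  exact family_injective D.famφ_injective h false

lemma inter {a : A} {b : B} (h : D.iA a = D.iB b) : ∃ c, D.φA c = a ∧ D.φB c = b := by
  obtain ⟨θ, hθ⟩ := D.exists_hom
  obtain ⟨c, hc⟩ := family_inter D.famφ_injective hθ (u := true) (x := a) (y := b) h
  refine ⟨c, hc, D.iB_injective ?_⟩
  rw [← D.comm, ← h]
  exact congrArg D.iA hc

lemma isAmalgam : IsAmalgam (pairS D.iA.range D.iB.range) := by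
  obtain ⟨θ, hθ⟩ := D.exists_hom
  have := family_isAmalgam (i := D.fami) D.famφ_injective (by
    rintro (_ | _) c
    · exact (D.comm c).symm
    · exact D.comm c) hθ D.gen
  have e : (fun u => (D.fami u).range) = pairS D.iA.range D.iB.range := by
    funext u; cases u <;> rfl
  rwa [e] at this

end AmalgamData

namespace TreeMetric

variable {V : Type*} {T : TreeMetric V}

lemma edge_split {x y z p q : V} (hpq : T.d p q = 1) (h : T.d x p + 1 + T.d q z = T.d x z) :
    T.d x p + 1 + T.d q y = T.d x y ∨ T.d y p + 1 + T.d q z = T.d y z := by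
  have f1 := T.four_all x p q y
  have f2 := T.four_all z p q y
  have f3 := T.four_all x z p y
  have f4 := T.four_all x z q y
  have p1 := T.parity y p q
  have t1 := T.triangle x p z
  have t2 := T.triangle x q z
  have t3 := T.triangle p q z
  have t4 := T.triangle x p q
  have t5 := T.triangle y p z
  have t6 := T.triangle x q y
  have s1 := T.symm y p
  have s2 := T.symm y q
  have s3 := T.symm y z
  have s4 := T.symm z p
  have s5 := T.symm z q
  rw [Nat.even_iff] at p1
  omega

section Action

variable {G : Type*} [Group G] [MulAction G V]

lemma Hyp.between (hT : T.Acts G) {g : G} {x : V} (hg : T.Hyp g x) (y : V) :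
    ∃ N : ℕ, T.d (g⁻¹ ^ N • y) x + T.d x (g ^ N • y) = T.d (g⁻¹ ^ N • y) (g ^ N • y) := by
  refine ⟨T.d x y + 1, ?_⟩
  set N := T.d x y + 1 with hN
  have a1 := hg.pow hT N
  have a2 := (hg.inv hT).pow hT N
  rw [Hyp.d_inv hT] at a2
  have a3 := hg.pow hT (N + N)
  have a4 : T.d (g⁻¹ ^ N • x) (g ^ N • x) = (N + N) * T.d x (g • x) := by
    rw [inv_pow, hT.d_inv, ← mul_smul, ← pow_add, a3]
  have b1 := hT.iso (g ^ N) x y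
  have b2 := hT.iso (g⁻¹ ^ N) x y
  have hL : N ≤ N * T.d x (g • x) := Nat.le_mul_of_pos_right _ hg.1
  rw [add_mul] at a4
  have f1 := T.four_all x (g⁻¹ ^ N • x) (g ^ N • x) (g⁻¹ ^ N • y)
  have f2 := T.four_all x (g⁻¹ ^ N • y) (g ^ N • x) (g ^ N • y)
  have s1 := T.symm x (g⁻¹ ^ N • y)
  have s2 := T.symm (g ^ N • x) (g⁻¹ ^ N • y)
  have t1 := T.triangle (g⁻¹ ^ N • y) x (g ^ N • x)
  have t2 := T.triangle (g⁻¹ ^ N • y) x (g ^ N • y)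
  have t3 := T.triangle x (g⁻¹ ^ N • y) (g⁻¹ ^ N • x)
  have t4 := T.triangle x (g ^ N • y) (g ^ N • x)
  have s3 := T.symm (g ^ N • x) (g ^ N • y)
  have s4 := T.symm (g⁻¹ ^ N • x) (g⁻¹ ^ N • y)
  omega

lemma Hyp.of_between (hT : T.Acts G) {g : G} {x z : V} (hg : T.Hyp g x)
    (hz : T.d x z + T.d z (g • x) = T.d x (g • x)) : T.Hyp g z := by
  have a2 := hg.pow hT 2
  have a3 := hg.pow hT 3
  simp only [pow_succ, pow_zero, one_mul, mul_smul] at a2 a3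
  have h0 := hg.1
  have i1 := hT.iso g x z
  have i2 := hT.iso g z (g • x)
  have i3 := hT.iso g (g • z) (g • g • x)
  have i4 := hT.iso g (g • x) (g • z)
  have t1 := T.triangle z (g • x) (g • z)
  have t2 := T.triangle x z (g • z)
  have t3 := T.triangle x (g • z) (g • g • x)
  have t4 := T.triangle x z (g • g • z)
  have t5 := T.triangle x (g • g • z) (g • g • g • x)
  have t6 := T.triangle z (g • z) (g • g • z)
  have i5 := hT.iso g z (g • z)
  unfold Hyp
  omega

end Action

end TreeMetric

open IsAmalgam

/-- The homomorphism `f` maps the free product of the subgroups `S' true` and `S' false` to the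
amalgam of `S true` and `S false`, compatibly with the factors and avoiding the base. -/
structure FreeIn {G H : Type*} [Group G] [Group H] (S : Bool → Subgroup G)
    (S' : Bool → Subgroup H) (f : H →* G) : Prop where
  amalgam : IsAmalgam S
  top' : ∀ T : Subgroup H, S' true ≤ T → S' false ≤ T → T = ⊤
  base' : ∀ x, x ∈ S' true → x ∈ S' false → x = 1
  map : ∀ s x, x ∈ S' s → x ≠ 1 → f x ∈ S s ∧ f x ∉ S (!s)

namespace FreeIn

variable {G H : Type*} [Group G] [Group H] {S : Bool → Subgroup G} {S' : Bool → Subgroup H}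
  {f : H →* G} (hF : FreeIn S S' f)

include hF

lemma word {s t : Bool} {w : H} (h : AltWord S' s t w) : AltWord S s t (f w) :=
  h.mono f fun s x h1 h2 => hF.map s x h1 (by rintro rfl; exact h2 (one_mem _))

lemma map_mem {u : Bool} {w : H} (h : w ∈ S' u) : f w ∈ S u := by
  by_cases h1 : w = 1
  · rw [h1, map_one]; exact one_mem _
  · exact (hF.map u w h h1).1

lemma injective : Function.Injective f := by
  rw [injective_iff_map_eq_one]
  intro w hw
  rcases AltWord.cases_of_top hF.top' w with h | ⟨s, t, h⟩
  · exact hF.base' _ (h _) (h _)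
  · exact absurd hw (hF.amalgam.ne_one (hF.word h))

lemma mem_of_map_mem {u : Bool} {w : H} (hw : f w ∈ S u) : w ∈ S' u := by
  rcases AltWord.cases_of_top hF.top' w with h | ⟨s, t, h⟩
  · exact h _
  · have e1 := hF.amalgam.eq_of_mem (hF.word h) hw
    have e2 := hF.amalgam.eq_of_mem (hF.word h).inv (inv_mem hw)
    cases h with
    | single h h' => rwa [← e1]
    | @snoc t g x hg h h' =>
      subst e2
      have h1 : f g ∈ S (!t) := by
        rw [← Subgroup.mul_mem_cancel_right _ (hF.map_mem h), ← map_mul]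
        exact hw
      have := hF.amalgam.eq_of_mem (hF.word hg).inv (inv_mem h1)
      simp at this

omit hF in
variable (S) in
/-- The end of type `u` of the base edge. -/
def baseVertex (S : Bool → Subgroup G) : Bool → BSVertex S
  | true => Sum.inl ((1 : G) : G ⧸ S true)
  | false => Sum.inr ((1 : G) : G ⧸ S false)

omit hF in
lemma smul_baseVertex {u : Bool} {g : G} : g • baseVertex S u = baseVertex S u ↔ g ∈ S u := by
  cases u
  · exact fix_inr.trans (by simp)
  · exact fix_inl.trans (by simp)

omit hF in
lemma isLeft_baseVertex (g : G) (u : Bool) : (g • baseVertex S u).isLeft = u := by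
  rw [isLeft_smul]; cases u <;> rfl

omit hF in
variable (S f) in
/-- The translates of the base edge by the free product. -/
def Good (p q : BSVertex S) : Prop :=
  ∃ (k : H) (u : Bool), p = f k • baseVertex S u ∧ q = f k • baseVertex S (!u)

omit hF in
lemma Good.symm {p q : BSVertex S} (h : Good S f p q) : Good S f q p := by
  obtain ⟨k, u, rfl, rfl⟩ := h
  exact ⟨k, !u, rfl, by rw [Bool.not_not]⟩

/-- All edges of the geodesic from `x` to `y` are translates of the base edge. -/
def Ed (x y : BSVertex S) : Prop :=
  ∀ p q, hF.amalgam.metric.d p q = 1 →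
    hF.amalgam.metric.d x p + 1 + hF.amalgam.metric.d q y = hF.amalgam.metric.d x y → Good S f p q

lemma Ed.trans {x y z : BSVertex S} (h1 : hF.Ed x y) (h2 : hF.Ed y z) : hF.Ed x z := by
  intro p q hpq h
  rcases TreeMetric.edge_split (y := y) hpq h with h | h
  · exact h1 p q hpq h
  · exact h2 p q hpq h

lemma Ed.symm {x y : BSVertex S} (h1 : hF.Ed x y) : hF.Ed y x := by
  intro p q hpq h
  refine (h1 q p (by rw [hF.amalgam.metric.symm, hpq]) ?_).symm
  rw [hF.amalgam.metric.symm x q, hF.amalgam.metric.symm p y, hF.amalgam.metric.symm x y]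
  omega

lemma Ed.smul {x y : BSVertex S} (h1 : hF.Ed x y) (k : H) : hF.Ed (f k • x) (f k • y) := by
  intro p q hpq h
  have hT := hF.amalgam.acts
  obtain ⟨l, u, e1, e2⟩ := h1 ((f k)⁻¹ • p) ((f k)⁻¹ • q) (by rw [hT.iso, hpq]) (by
    rw [hT.iso] at h
    rw [← hT.iso (f k) x, ← hT.iso (f k) _ y, smul_inv_smul, smul_inv_smul, h])
  rw [inv_smul_eq_iff, ← mul_smul, ← map_mul] at e1 e2
  exact ⟨k * l, u, e1, e2⟩

lemma Ed.refl (x : BSVertex S) : hF.Ed x x := by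
  intro p q _ h
  rw [hF.amalgam.metric.d_self] at h
  omega

omit hF in
lemma adj_baseVertex (u : Bool) : (bsGraph S).Adj (baseVertex S u) (baseVertex S (!u)) := by
  cases u
  · exact ⟨1, Or.inr ⟨rfl, rfl⟩⟩
  · exact ⟨1, Or.inl ⟨rfl, rfl⟩⟩

lemma ed_edge (u : Bool) : hF.Ed (baseVertex S u) (baseVertex S (!u)) := by
  intro p q _ h
  rw [hF.amalgam.metric_eq_one.2 (adj_baseVertex u)] at h
  have e1 := hF.amalgam.metric.eq_of_d (x := baseVertex S u) (y := p) (by omega)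
  have e2 := hF.amalgam.metric.eq_of_d (x := q) (y := baseVertex S (!u)) (by omega)
  exact ⟨1, u, by simp [e1], by simp [e2]⟩

lemma ed_smul_one (k : H) :
    hF.Ed (baseVertex S true) (f k • baseVertex S true) := by
  let P : Subgroup H :=
    { carrier := {k | hF.Ed (baseVertex S true) (f k • baseVertex S true)}
      one_mem' := by
        change hF.Ed _ _
        rw [map_one, one_smul]
        exact Ed.refl hF _
      mul_mem' := by
        intro a b ha hb
        have := Ed.smul hF hb a
        rw [← mul_smul, ← map_mul] at this
        exact Ed.trans hF ha this
      inv_mem' := by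
        intro a ha
        have := Ed.smul hF ha a⁻¹
        rw [← mul_smul, ← map_mul, inv_mul_cancel, map_one, one_smul] at this
        exact Ed.symm hF this }
  have hP : P = ⊤ := by
    apply hF.top'
    · intro a ha
      change hF.Ed _ _
      rw [smul_baseVertex.2 (hF.map_mem ha)]
      exact Ed.refl hF _
    · intro b hb
      have h1 := hF.ed_edge true
      have h2 := Ed.smul hF h1 b
      rw [Bool.not_true, smul_baseVertex.2 (hF.map_mem hb)] at h2
      exact Ed.trans hF h1 (Ed.symm hF h2)
  exact (hP ▸ Subgroup.mem_top k : k ∈ P)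

lemma ed (k l : H) (u v : Bool) : hF.Ed (f k • baseVertex S u) (f l • baseVertex S v) := by
  have h1 : ∀ (k : H) (u : Bool), hF.Ed (baseVertex S true) (f k • baseVertex S u) := by
    rintro k (_ | _)
    · exact Ed.trans hF (hF.ed_smul_one k) (Ed.smul hF (hF.ed_edge true) k)
    · exact hF.ed_smul_one k
  exact Ed.trans hF (Ed.symm hF (h1 k u)) (h1 l v)

lemma exists_of_between {k l : H} {u v : Bool} {m : BSVertex S}
    (h : hF.amalgam.metric.d (f k • baseVertex S u) m +
      hF.amalgam.metric.d m (f l • baseVertex S v) =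
      hF.amalgam.metric.d (f k • baseVertex S u) (f l • baseVertex S v)) :
    ∃ (j : H) (t : Bool), m = f j • baseVertex S t := by
  rcases Nat.eq_zero_or_pos (hF.amalgam.metric.d (f k • baseVertex S u) m) with h0 | h0
  · exact ⟨k, u, (hF.amalgam.metric.eq_of_d h0).symm⟩
  · obtain ⟨p, h1, h2⟩ := hF.amalgam.metric.geod (f k • baseVertex S u) m
      (hF.amalgam.metric.d (f k • baseVertex S u) m - 1) (by omega)
    obtain ⟨j, t, _, h3⟩ := hF.ed k l u v p m (by omega) (by omega)
    exact ⟨j, _, h3⟩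

lemma exists_conj_mem {w : H} {x : BSVertex S} (hx : f w • x = x) :
    ∃ (k : H) (u : Bool), k⁻¹ * w * k ∈ S' u := by
  have hT := hF.amalgam.acts
  obtain ⟨m, h1, h2⟩ := TreeMetric.exists_midpoint _ (hT.even (f w) (baseVertex S true))
  have h3 := TreeMetric.midpoint_fixed hT hx h1 h2
  obtain ⟨j, t, rfl⟩ := hF.exists_of_between (k := 1) (u := true) (l := w) (v := true) (m := m)
    (by rw [map_one, one_smul]; exact h2)
  refine ⟨j, t, hF.mem_of_map_mem ?_⟩
  rw [← smul_baseVertex, map_mul, map_mul, mul_smul, mul_smul, h3, ← mul_smul, ← map_mul,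
    inv_mul_cancel, map_one, one_smul]

lemma exists_of_hyp {w : H} {x : BSVertex S} (hx : hF.amalgam.metric.Hyp (f w) x) :
    ∃ k : H, x = f k • baseVertex S x.isLeft := by
  obtain ⟨N, hN⟩ := hx.between hF.amalgam.acts (baseVertex S true)
  rw [← map_inv, ← map_pow, ← map_pow] at hN
  obtain ⟨j, t, rfl⟩ := hF.exists_of_between hN
  exact ⟨j, by rw [isLeft_baseVertex]⟩

lemma exists_first_edge {k : H} (hk : f k • baseVertex S false ≠ baseVertex S false) :
    ∃ l ∈ S' false, hF.amalgam.metric.d (baseVertex S false) (f l • baseVertex S true) = 1 ∧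
      1 + hF.amalgam.metric.d (f l • baseVertex S true) (f k • baseVertex S false) =
        hF.amalgam.metric.d (baseVertex S false) (f k • baseVertex S false) := by
  have h0 : 0 < hF.amalgam.metric.d (baseVertex S false) (f k • baseVertex S false) := by
    rcases Nat.eq_zero_or_pos
      (hF.amalgam.metric.d (baseVertex S false) (f k • baseVertex S false)) with h | h
    · exact absurd (hF.amalgam.metric.eq_of_d h).symm hk
    · exact h
  obtain ⟨q, h1, h2⟩ := hF.amalgam.metric.geod _ _ 1 h0
  have := hF.ed 1 k false false (baseVertex S false) q h1 (by
    rw [map_one, one_smul, hF.amalgam.metric.d_self]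
    omega)
  obtain ⟨l, u, e1, e2⟩ := this
  have hu := congrArg Sum.isLeft e1
  rw [isLeft_baseVertex] at hu
  have : u = false := hu.symm
  subst this
  subst e2
  exact ⟨l, hF.mem_of_map_mem (smul_baseVertex.1 e1.symm), h1, by rw [h1] at h2; exact h2⟩

lemma first_edge_unique {k : H} {q q' : BSVertex S}
    (h1 : hF.amalgam.metric.d (baseVertex S false) q = 1)
    (h2 : 1 + hF.amalgam.metric.d q (f k • baseVertex S false) =
        hF.amalgam.metric.d (baseVertex S false) (f k • baseVertex S false))
    (h1' : hF.amalgam.metric.d (baseVertex S false) q' = 1)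
    (h2' : 1 + hF.amalgam.metric.d q' (f k • baseVertex S false) =
        hF.amalgam.metric.d (baseVertex S false) (f k • baseVertex S false)) : q = q' :=
  hF.amalgam.metric.eq_of_between (w := f k • baseVertex S false) (by rw [h1]; exact h2) (by rw [h1']; exact h2')
    (by rw [h1, h1'])

lemma transfer_edge {w w' : H} {d : G} (hd : d ∈ S false) (e : d * f w' = f w * d)
    (hw : f w' • baseVertex S false ≠ baseVertex S false) {l : H}
    (h1 : hF.amalgam.metric.d (baseVertex S false) (f l • baseVertex S true) = 1)
    (h2 : 1 + hF.amalgam.metric.d (f l • baseVertex S true) (f w' • baseVertex S false) =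
        hF.amalgam.metric.d (baseVertex S false) (f w' • baseVertex S false)) :
    ∃ j ∈ S' false, (f j)⁻¹ * d * f l ∈ S true := by
  have hT := hF.amalgam.acts
  have hd' := smul_baseVertex.2 hd
  have e' : d • f w' • baseVertex S false = f w • baseVertex S false := by
    rw [← mul_smul, e, mul_smul, hd']
  obtain ⟨j, hj, h3, h4⟩ := hF.exists_first_edge (k := w) (by
    intro h
    rw [← e'] at h
    apply hw
    rw [← smul_left_cancel_iff d, h, hd'])
  refine ⟨j, hj, ?_⟩
  have := hF.first_edge_unique (k := w) (q := d • f l • baseVertex S true)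
    (by rw [← hT.iso d, hd'] at h1; exact h1)
    (by
      rw [← hT.iso d, ← hT.iso d (baseVertex S false), hd', e'] at h2
      exact h2) h3 h4
  rw [← smul_baseVertex, mul_smul, mul_smul, this, inv_smul_smul]

lemma hyp_conj {w w' : H} {d : G} (hd : d ∈ S false) (e : d * f w' = f w * d)
    (hw : hF.amalgam.metric.Hyp (f w') (baseVertex S false)) :
    ∃ l₁ ∈ S' false, ∃ l₂ ∈ S' false, ∃ j₁ ∈ S' false, ∃ j₂ ∈ S' false, l₁ ≠ l₂ ∧
      (f j₁)⁻¹ * d * f l₁ ∈ S true ∧ (f j₂)⁻¹ * d * f l₂ ∈ S true := by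
  have hT := hF.amalgam.acts
  have n1 : f w' • baseVertex S false ≠ baseVertex S false := by
    intro h
    have := hw.1
    rw [h, hF.amalgam.metric.d_self] at this
    omega
  have n2 : f w'⁻¹ • baseVertex S false ≠ baseVertex S false := by
    rw [map_inv, Ne, inv_smul_eq_iff]
    exact n1.symm
  have e' : d * f w'⁻¹ = f w⁻¹ * d := by
    rw [map_inv, map_inv, mul_inv_eq_iff_eq_mul, mul_assoc, e, inv_mul_cancel_left]
  obtain ⟨l₁, hl₁, a1, a2⟩ := hF.exists_first_edge n1
  obtain ⟨l₂, hl₂, b1, b2⟩ := hF.exists_first_edge n2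
  obtain ⟨j₁, hj₁, h1⟩ := hF.transfer_edge hd e n1 a1 a2
  obtain ⟨j₂, hj₂, h2⟩ := hF.transfer_edge hd e' n2 b1 b2
  refine ⟨l₁, hl₁, l₂, hl₂, j₁, hj₁, j₂, hj₂, ?_, h1, h2⟩
  rintro rfl
  have t := hF.amalgam.metric.triangle (f w'⁻¹ • baseVertex S false) (f l₁ • baseVertex S true)
    (f w' • baseVertex S false)
  rw [hF.amalgam.metric.symm _ (f l₁ • baseVertex S true)] at t
  have h3 := TreeMetric.Hyp.d_inv hT (g := f w') (x := baseVertex S false)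
  rw [← map_inv] at h3
  have h4 : hF.amalgam.metric.d (f w'⁻¹ • baseVertex S false) (f w' • baseVertex S false) =
      2 * hF.amalgam.metric.d (baseVertex S false) (f w' • baseVertex S false) := by
    rw [map_inv, hT.d_inv]
    exact hw.2
  omega

lemma conj_alternative {w w' : H} {a : G} (e : a⁻¹ * f w * a = f w') :
    (∃ (k : H) (u : Bool), k⁻¹ * w * k ∈ S' u) ∨
    ∃ k k' : H, ∃ l₁ ∈ S' false, ∃ l₂ ∈ S' false, ∃ j₁ ∈ S' false, ∃ j₂ ∈ S' false, l₁ ≠ l₂ ∧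
      (f k)⁻¹ * a * f k' ∈ S false ∧
      (f j₁)⁻¹ * ((f k)⁻¹ * a * f k') * f l₁ ∈ S true ∧
      (f j₂)⁻¹ * ((f k)⁻¹ * a * f k') * f l₂ ∈ S true := by
  have hT := hF.amalgam.acts
  have : Nonempty (BSVertex S) := ⟨baseVertex S true⟩
  by_cases hfix : ∃ x : BSVertex S, f w • x = x
  · obtain ⟨x, hx⟩ := hfix
    exact Or.inl (hF.exists_conj_mem hx)
  push Not at hfix
  right
  obtain ⟨x, hx, hxl⟩ : ∃ x, hF.amalgam.metric.Hyp (f w) x ∧ x.isLeft = false := by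
    obtain ⟨x, hx⟩ := TreeMetric.exists_hyp hT hfix
    obtain ⟨z, hz1, hz2⟩ := hF.amalgam.metric.geod _ _ 1 hx.1
    cases hl : x.isLeft
    · exact ⟨x, hx, hl⟩
    · refine ⟨z, hx.of_between hT hz2, ?_⟩
      have := hF.amalgam.dist_parity x z
      rw [hz1, hl] at this
      cases hz : z.isLeft
      · rfl
      · rw [hz] at this; simp at this
  obtain ⟨k, hk⟩ := hF.exists_of_hyp hx
  have hx' : hF.amalgam.metric.Hyp (f w') (a⁻¹ • x) := by
    have := hx.conj hT a⁻¹
    rwa [inv_inv, e] at this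
  obtain ⟨k', hk'⟩ := hF.exists_of_hyp hx'
  rw [isLeft_smul] at hk'
  rw [hxl] at hk hk'
  have hd : (f k)⁻¹ * a * f k' ∈ S false := by
    rw [← smul_baseVertex, mul_smul, mul_smul, ← hk', smul_inv_smul, hk, inv_smul_smul]
  obtain ⟨l₁, hl₁, l₂, hl₂, j₁, hj₁, j₂, hj₂, h⟩ := hF.hyp_conj (w := k⁻¹ * w * k)
    (w' := k'⁻¹ * w' * k') hd (by
      simp only [map_mul, map_inv, ← e]
      group) (by
      have := hx'.conj hT (f k')⁻¹
      rw [hk', inv_smul_smul, inv_inv] at this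
      simpa using this)
  exact ⟨k, k', l₁, hl₁, l₂, hl₂, j₁, hj₁, j₂, hj₂, h.1, hd, h.2⟩

end FreeIn

lemma IsAmalgam.fixed_unique {G : Type*} [Group G] {S : Bool → Subgroup G} (hS : IsAmalgam S)
    {x : G} (hx : x ∈ S true) (h : ∀ k ∈ S true, k⁻¹ * x * k ∉ S false) {v : BSVertex S}
    (hv : x • v = v) : v = Sum.inl ((1 : G) : G ⧸ S true) := by
  by_contra hne
  have h0 : 0 < hS.metric.d (Sum.inl ((1 : G) : G ⧸ S true)) v := by
    rcases Nat.eq_zero_or_pos (hS.metric.d (Sum.inl ((1 : G) : G ⧸ S true)) v) with h | h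
    · exact absurd (hS.metric.eq_of_d h).symm hne
    · exact h
  obtain ⟨q, h1, h2⟩ := hS.metric.geod _ _ 1 h0
  have hb : x • (Sum.inl ((1 : G) : G ⧸ S true) : BSVertex S) = Sum.inl ((1 : G) : G ⧸ S true) :=
    fix_inl.2 (by simpa using hx)
  have h3 := TreeMetric.fixed_of_between hS.acts hb hv h2
  obtain ⟨k, ⟨e1, rfl⟩ | ⟨_, e2⟩⟩ := hS.metric_eq_one.1 h1
  · rw [fix_inr] at h3
    rw [Sum.inl.injEq, QuotientGroup.eq] at e1
    exact h k (by simpa using e1) h3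
  · simp at e2

section BaumslagSolitar

variable {G : Type*} [Group G] {x y : G}

lemma conj_pow_rel (h : x * y * x⁻¹ = y ^ 2) (j : ℕ) (e : ℤ) :
    x ^ j * y ^ e = y ^ (e * 2 ^ j) * x ^ j := by
  have h1 : ∀ e : ℤ, x * y ^ e = y ^ (e * 2) * x := by
    intro e
    rw [← mul_inv_eq_iff_eq_mul, ← conj_zpow, h, mul_comm, zpow_mul, zpow_ofNat]
  induction j generalizing e with
  | zero => simp
  | succ j ih => rw [pow_succ, mul_assoc, h1, ← mul_assoc, ih, mul_assoc, mul_assoc, pow_succ 2,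
      mul_comm (2 ^ j) (2 : ℤ)]

lemma exists_normal_form (h : x * y * x⁻¹ = y ^ 2)
    (hgen : ∀ T : Subgroup G, x ∈ T → y ∈ T → T = ⊤) (g : G) :
    ∃ (i j : ℕ) (k : ℤ), g = (x ^ i)⁻¹ * y ^ k * x ^ j := by
  let N : G → Prop := fun g => ∃ (i j : ℕ) (k : ℤ), g = (x ^ i)⁻¹ * y ^ k * x ^ j
  let P : Subgroup G :=
    { carrier := {h | (∀ g, N g → N (g * h)) ∧ ∀ g, N g → N (g * h⁻¹)}
      one_mem' := by simp
      mul_mem' := by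
        rintro a b ⟨h1, h2⟩ ⟨h3, h4⟩
        refine ⟨fun g hg => ?_, fun g hg => ?_⟩
        · rw [← mul_assoc]; exact h3 _ (h1 _ hg)
        · rw [mul_inv_rev, ← mul_assoc]; exact h2 _ (h4 _ hg)
      inv_mem' := by
        rintro a ⟨h1, h2⟩
        exact ⟨h2, by simpa using h1⟩ }
  have hy : ∀ (e : ℤ) g, N g → N (g * y ^ e) := by
    rintro e _ ⟨i, j, k, rfl⟩
    refine ⟨i, j, k + e * 2 ^ j, ?_⟩
    rw [mul_assoc, conj_pow_rel h, zpow_add]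
    group
  have hP : P = ⊤ := by
    apply hgen
    · refine ⟨?_, ?_⟩
      · rintro _ ⟨i, j, k, rfl⟩
        exact ⟨i, j + 1, k, by rw [pow_succ, mul_assoc]⟩
      · rintro _ ⟨i, j, k, rfl⟩
        refine ⟨i + 1, j, k * 2, ?_⟩
        have := conj_pow_rel h 1 k
        rw [pow_one, pow_one, ← mul_inv_eq_iff_eq_mul] at this
        rw [← this, pow_succ']
        have e : x⁻¹ * x ^ j = x ^ j * x⁻¹ := by
          rw [inv_mul_eq_iff_eq_mul, ← mul_assoc, ← pow_succ', pow_succ, mul_inv_cancel_right]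
        rw [mul_inv_rev]
        simp only [mul_assoc, e]
        group
    · exact ⟨fun g hg => by simpa using hy 1 g hg, fun g hg => by simpa using hy (-1) g hg⟩
  have hg : g ∈ P := hP ▸ Subgroup.mem_top g
  have := hg.1 1 ⟨0, 0, 0, by simp⟩
  simpa using this

end BaumslagSolitar

/-- The relations of the chain group on generators `c 0, ..., c m`. -/
def chainRels (m : ℕ) : Set (FreeGroup ℕ) :=
  {r | (∃ i < m, r = FreeGroup.of i * FreeGroup.of (i + 1) * (FreeGroup.of i)⁻¹ *
      ((FreeGroup.of (i + 1))⁻¹) ^ 2) ∨ ∃ i > m, r = FreeGroup.of i}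

/-- The chain group: generated by `c 0, ..., c m`, with `c i` conjugating `c (i + 1)` to its
square. -/
abbrev Chain (m : ℕ) : Type := PresentedGroup (chainRels m)

namespace Chain

/-- The generators of the chain group. -/
def c (m i : ℕ) : Chain m := PresentedGroup.of i

lemma rel {m i : ℕ} (hi : i < m) : c m i * c m (i + 1) * (c m i)⁻¹ = c m (i + 1) ^ 2 := by
  have := PresentedGroup.one_of_mem (rels := chainRels m) (Or.inl ⟨i, hi, rfl⟩)
  rw [map_mul, map_pow, map_inv, inv_pow, mul_inv_eq_one] at this
  rw [map_mul, map_mul, map_inv] at this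
  exact this

lemma eq_one {m i : ℕ} (hi : m < i) : c m i = 1 :=
  PresentedGroup.one_of_mem (rels := chainRels m) (Or.inr ⟨i, hi, rfl⟩)

lemma exists_lift {P : Type*} [Group P] (m : ℕ) (g : ℕ → P)
    (hg : ∀ i < m, g i * g (i + 1) * (g i)⁻¹ = g (i + 1) ^ 2) :
    ∃ θ : Chain m →* P, ∀ i ≤ m, θ (c m i) = g i := by
  refine ⟨PresentedGroup.toGroup (f := fun i => if i ≤ m then g i else 1) ?_, fun i hi => ?_⟩
  · rintro r (⟨i, hi, rfl⟩ | ⟨i, hi, rfl⟩)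
    · simp only [map_mul, map_inv, map_pow, FreeGroup.lift_apply_of]
      rw [if_pos hi.le, if_pos (show i + 1 ≤ m from hi), inv_pow, mul_inv_eq_one]
      exact hg i hi
    · rw [FreeGroup.lift_apply_of, if_neg (by omega)]
  · rw [c, PresentedGroup.toGroup.of, if_pos hi]

lemma gen {m : ℕ} (T : Subgroup (Chain m)) (h : ∀ i ≤ m, c m i ∈ T) : T = ⊤ := by
  rw [eq_top_iff, ← PresentedGroup.closure_range_of, Subgroup.closure_le]
  rintro _ ⟨i, rfl⟩
  by_cases hi : i ≤ m
  · exact h i hi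
  · have : c m i = 1 := eq_one (by omega)
    change c m i ∈ T
    rw [this]
    exact one_mem T

lemma hom_ext {P : Type*} [Group P] {m : ℕ} {f g : Chain m →* P}
    (h : ∀ i ≤ m, f (c m i) = g (c m i)) : f = g := by
  have := gen (f.eqLocus g) h
  exact MonoidHom.ext fun x => (this ▸ Subgroup.mem_top x : x ∈ f.eqLocus g)

/-- The properties of chain groups which are proved by induction. -/
structure Good (m : ℕ) : Prop where
  indep : ∀ p q : ℤ, c m 0 ^ p = c m m ^ q → p = 0 ∧ q = 0
  malnormal : ∀ (p q : ℤ) (g : Chain m), p ≠ 0 → g⁻¹ * c m 0 ^ p * g = c m 0 ^ q →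
    g ∈ Subgroup.zpowers (c m 0)
  tits : TitsAlt (Chain m)

lemma Good.first {m : ℕ} (h : Good m) {p : ℤ} (hp : c m 0 ^ p = 1) : p = 0 :=
  (h.indep p 0 (by rw [hp, zpow_zero])).1

lemma Good.last {m : ℕ} (h : Good m) {p : ℤ} (hp : c m m ^ p = 1) : p = 0 :=
  (h.indep 0 p (by rw [hp, zpow_zero])).2

lemma exists_height : ∃ τ : Chain 1 →* Multiplicative ℤ,
    τ (c 1 0) = Multiplicative.ofAdd 1 ∧ τ (c 1 1) = 1 := by
  obtain ⟨θ, hθ⟩ := exists_lift 1 (fun i => if i = 0 then Multiplicative.ofAdd (1 : ℤ) else 1)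
    (by rintro i hi; simp)
  exact ⟨θ, by rw [hθ 0 (by simp)]; simp, by rw [hθ 1 le_rfl]; simp⟩

lemma height_eq_zero {p q : ℤ} {g h : Chain 1}
    (e : g⁻¹ * c 1 0 ^ p * g = h⁻¹ * c 1 1 ^ q * h) : p = 0 := by
  obtain ⟨τ, h0, h1⟩ := exists_height
  have := congrArg τ e
  simp only [map_mul, map_inv, map_zpow, h0, h1, one_zpow, mul_one, inv_mul_cancel] at this
  rw [mul_comm, mul_inv_cancel_left] at this
  have := congrArg Multiplicative.toAdd this
  simpa using this

lemma exists_affine : ∃ τ : Chain 1 →* Equiv.Perm ℚ,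
    (∀ (n : ℤ) (q : ℚ), τ (c 1 0 ^ n) q = 2 ^ n * q) ∧
      ∀ (n : ℤ) (q : ℚ), τ (c 1 1 ^ n) q = n + q := by
  let X : Equiv.Perm ℚ := Equiv.mulLeft₀ 2 two_ne_zero
  let Y : Equiv.Perm ℚ := Equiv.addLeft 1
  obtain ⟨θ, hθ⟩ := exists_lift 1 (fun i => if i = 0 then X else Y) (by
    intro i hi
    obtain rfl : i = 0 := by omega
    simp only [if_true, zero_add, one_ne_zero, if_false, mul_inv_eq_iff_eq_mul]
    have hX : ∀ q : ℚ, X q = 2 * q := fun q => rfl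
    have hY : ∀ q : ℚ, Y q = 1 + q := fun q => rfl
    ext q
    simp only [Equiv.Perm.mul_apply, pow_two, hX, hY]
    ring)
  have h0 := hθ 0 (by simp)
  have h1 := hθ 1 le_rfl
  simp only [if_true, one_ne_zero, if_false] at h0 h1
  refine ⟨θ, ?_, ?_⟩
  · have hX : ∀ q : ℚ, X q = 2 * q := fun q => rfl
    intro n
    rw [map_zpow, h0]
    induction n using Int.induction_on with
    | zero => simp
    | succ n ih =>
      intro q
      rw [zpow_add, zpow_one, Equiv.Perm.mul_apply, ih, hX, zpow_add₀ two_ne_zero]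
      ring
    | pred n ih =>
      intro q
      rw [zpow_sub, zpow_one, Equiv.Perm.mul_apply, ih, zpow_sub₀ two_ne_zero, zpow_one]
      have : X⁻¹ q = q / 2 := by
        rw [Equiv.Perm.inv_eq_iff_eq, hX]
        ring
      rw [this]
      ring
  · have hY : ∀ q : ℚ, Y q = 1 + q := fun q => rfl
    intro n
    rw [map_zpow, h1]
    induction n using Int.induction_on with
    | zero => simp
    | succ n ih =>
      intro q
      rw [zpow_add, zpow_one, Equiv.Perm.mul_apply, ih, hY]
      push_cast
      ring
    | pred n ih =>
      intro q
      rw [zpow_sub, zpow_one, Equiv.Perm.mul_apply, ih]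
      have : Y⁻¹ q = q - 1 := by
        rw [Equiv.Perm.inv_eq_iff_eq, hY]
        ring
      rw [this]
      push_cast
      ring

lemma normal_form (g : Chain 1) :
    ∃ (i j : ℕ) (k : ℤ), g = (c 1 0 ^ i)⁻¹ * c 1 1 ^ k * c 1 0 ^ j :=
  exists_normal_form (rel (m := 1) (i := 0) one_pos) (fun T h0 h1 => gen T fun i hi => by
    interval_cases i <;> assumption) g

lemma exists_hom_BS12 : ∃ f : Chain 1 →* BS12, Function.Injective f := by
  have hr : (PresentedGroup.of 0 : BS12) * PresentedGroup.of 1 * (PresentedGroup.of 0)⁻¹ =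
      PresentedGroup.of 1 ^ 2 := by
    have := PresentedGroup.one_of_mem (rels := bsRels) rfl
    rw [map_mul, map_pow, map_inv, inv_pow, mul_inv_eq_one, map_mul, map_mul, map_inv] at this
    exact this
  obtain ⟨θ, hθ⟩ := exists_lift 1
    (fun i => if i = 0 then (PresentedGroup.of 0 : BS12) else PresentedGroup.of 1) (by
      intro i hi
      obtain rfl : i = 0 := by omega
      simpa using hr)
  let ψ : BS12 →* Chain 1 := PresentedGroup.toGroup (f := ![c 1 0, c 1 1]) (by
    rintro _ rfl
    simp only [map_mul, map_inv, map_pow, FreeGroup.lift_apply_of, Matrix.cons_val_zero,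
      Matrix.cons_val_one]
    rw [inv_pow, mul_inv_eq_one]
    exact rel one_pos)
  have : ψ.comp θ = MonoidHom.id _ := by
    apply hom_ext
    intro i hi
    rw [MonoidHom.comp_apply, hθ i hi]
    interval_cases i <;> simp [ψ]
  exact ⟨θ, fun a b hab => by
    have h1 := DFunLike.congr_fun this a
    have h2 := DFunLike.congr_fun this b
    simp only [MonoidHom.comp_apply, MonoidHom.id_apply] at h1 h2
    rw [← h1, ← h2, hab]⟩

lemma good_one : Good 1 := by
  obtain ⟨τ, h0, h1⟩ := exists_affine
  have last : ∀ q : ℤ, c 1 1 ^ q = 1 → q = 0 := by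
    intro q hq
    have := h1 q 0
    rw [hq, map_one] at this
    simpa using this.symm
  constructor
  · intro p q h
    have hp : p = 0 := height_eq_zero (g := 1) (h := 1) (q := q) (by simpa using h)
    rw [hp, zpow_zero] at h
    exact ⟨hp, last q h.symm⟩
  · intro p q g hp h
    obtain ⟨i, j, k, rfl⟩ := normal_form g
    have h' : c 1 1 ^ (-k) * c 1 0 ^ p * c 1 1 ^ k = c 1 0 ^ q := by
      have : c 1 0 ^ q = c 1 0 ^ j * c 1 0 ^ q * (c 1 0 ^ j)⁻¹ := by group
      rw [this, ← h]
      group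
    have h2 := congrArg (fun g => τ g 0) h'
    simp only [map_mul, Equiv.Perm.mul_apply, h0, h1, add_zero, mul_zero, Int.cast_neg] at h2
    have h3 : (k : ℚ) * (2 ^ p - 1) = 0 := by linarith
    rcases mul_eq_zero.1 h3 with h4 | h4
    · have hk : k = 0 := by exact_mod_cast h4
      rw [hk, zpow_zero, mul_one]
      exact mul_mem (inv_mem (pow_mem (Subgroup.mem_zpowers _) _))
        (pow_mem (Subgroup.mem_zpowers _) _)
    · exfalso
      apply hp
      have h5 : (2 : ℚ) ^ p = 2 ^ (0 : ℤ) := by rw [zpow_zero]; linarith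
      exact zpow_right_injective₀ (by norm_num) (by norm_num) h5
  · refine ⟨fun g hg => ?_, fun H _ f hf => ?_⟩
    · obtain ⟨i, j, k, rfl⟩ := normal_form g
      obtain ⟨σ, s0, s1⟩ := exists_height
      have e := congrArg (fun g => Multiplicative.toAdd (σ g)) hg
      simp only [map_mul, map_inv, map_pow, map_zpow, s0, s1, one_zpow, mul_one, toAdd_mul,
        toAdd_inv, toAdd_pow, toAdd_ofAdd, map_one, toAdd_one, nsmul_eq_mul] at e
      have hij : i = j := by omega
      subst hij
      have hk : c 1 1 ^ (k + k) = 1 := by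
        have : c 1 1 ^ (k + k) = c 1 0 ^ i * ((c 1 0 ^ i)⁻¹ * c 1 1 ^ k * c 1 0 ^ i *
          ((c 1 0 ^ i)⁻¹ * c 1 1 ^ k * c 1 0 ^ i)) * (c 1 0 ^ i)⁻¹ := by
          rw [zpow_add]; group
        rw [this, hg, mul_one, mul_inv_cancel]
      have := last _ hk
      obtain rfl : k = 0 := by omega
      simp
    · obtain ⟨θ, hθ⟩ := exists_hom_BS12
      exact Or.inr (Or.inl ⟨θ.comp f, hθ.comp hf⟩)

end Chain

lemma TitsAlt.range {G A : Type} [Group G] [Group A] (hA : TitsAlt A) {i : A →* G}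
    (hi : Function.Injective i) : TitsAlt i.range :=
  hA.of_injective (MonoidHom.ofInjective hi).symm.toMonoidHom (MonoidHom.ofInjective hi).symm.injective

lemma zpowersHom_injective {G : Type} [Group G] {x : G} (h : ∀ p : ℤ, x ^ p = 1 → p = 0) :
    Function.Injective (zpowersHom G x) := by
  rw [injective_iff_map_eq_one]
  intro a ha
  rw [zpowersHom_apply] at ha
  exact Multiplicative.toAdd.injective (h _ ha)

namespace Chain

lemma exists_data {m : ℕ} (hm : Good m) :
    ∃ D : AmalgamData (Chain (m + 1)) (Chain 1) (Chain m) (Multiplicative ℤ),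
      D.φA = zpowersHom _ (c 1 1) ∧ D.φB = zpowersHom _ (c m 0) ∧
      D.iA (c 1 0) = c (m + 1) 0 ∧ ∀ i ≤ m, D.iB (c m i) = c (m + 1) (i + 1) := by
  obtain ⟨iA, hA⟩ := exists_lift 1 (fun i => c (m + 1) i) fun i hi => rel (by omega)
  obtain ⟨iB, hB⟩ := exists_lift m (fun i => c (m + 1) (i + 1)) fun i hi => rel (by omega)
  refine ⟨⟨zpowersHom _ (c 1 1), zpowersHom _ (c m 0), iA, iB,
    zpowersHom_injective fun _ => good_one.last, zpowersHom_injective fun _ => hm.first,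
    ?_, ?_, ?_⟩, rfl, rfl, hA 0 zero_le_one, hB⟩
  · intro z
    rw [zpowersHom_apply, zpowersHom_apply, map_zpow, map_zpow, hA 1 le_rfl, hB 0 (Nat.zero_le _)]
  · intro T h1 h2
    refine gen T fun i hi => ?_
    rcases i with _ | i
    · exact h1 ⟨_, hA 0 zero_le_one⟩
    · exact h2 ⟨_, hB i (by omega)⟩
  · intro P _ α β h
    have h' : α (c 1 1) = β (c m 0) := by
      have := h (Multiplicative.ofAdd 1)
      simpa [zpowersHom_apply] using this
    obtain ⟨θ, hθ⟩ := exists_lift (m + 1) 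
      (fun i => if i = 0 then α (c 1 0) else β (c m (i - 1)))
      (by
        rintro (_ | i) hi
        · change α (c 1 0) * β (c m 0) * (α (c 1 0))⁻¹ = β (c m 0) ^ 2
          rw [← h', ← map_inv, ← map_mul, ← map_mul, ← map_pow, rel (m := 1) one_pos]
        · change β (c m i) * β (c m (i + 1)) * (β (c m i))⁻¹ = β (c m (i + 1)) ^ 2
          rw [← map_inv, ← map_mul, ← map_mul, ← map_pow, rel (by omega)])
    refine ⟨θ, fun a => ?_, fun b => ?_⟩
    · have : θ.comp iA = α := by
        apply hom_ext
        intro i hi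
        rw [MonoidHom.comp_apply, hA i hi, hθ i (by omega)]
        interval_cases i
        · rfl
        · exact h'.symm
      exact DFunLike.congr_fun this a
    · have : θ.comp iB = β := by
        apply hom_ext
        intro i hi
        rw [MonoidHom.comp_apply, hB i hi, hθ _ (by omega)]
        rfl
      exact DFunLike.congr_fun this b

section Step

variable {m : ℕ} (hm : Good m)

/-- The splitting of a chain group over a generator. -/
noncomputable def data : AmalgamData (Chain (m + 1)) (Chain 1) (Chain m) (Multiplicative ℤ) :=
  (exists_data hm).choose

/-- The vertex groups of the splitting. -/
noncomputable def parts : Bool → Subgroup (Chain (m + 1)) :=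
  pairS (data hm).iA.range (data hm).iB.range

lemma parts_isAmalgam : IsAmalgam (parts hm) := (data hm).isAmalgam

lemma data_iA : (data hm).iA (c 1 0) = c (m + 1) 0 := (exists_data hm).choose_spec.2.2.1

lemma data_iB {i : ℕ} (hi : i ≤ m) : (data hm).iB (c m i) = c (m + 1) (i + 1) :=
  (exists_data hm).choose_spec.2.2.2 i hi

lemma data_inter {a : Chain 1} {b : Chain m} (h : (data hm).iA a = (data hm).iB b) :
    ∃ n : ℤ, a = c 1 1 ^ n ∧ b = c m 0 ^ n := by
  obtain ⟨z, h1, h2⟩ := (data hm).inter h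
  rw [data, (exists_data hm).choose_spec.1, zpowersHom_apply] at h1
  rw [data, (exists_data hm).choose_spec.2.1, zpowersHom_apply] at h2
  exact ⟨_, h1.symm, h2.symm⟩

lemma first_mem (p : ℤ) : c (m + 1) 0 ^ p ∈ parts hm true :=
  zpow_mem (MonoidHom.mem_range.2 ⟨_, data_iA hm⟩ : _ ∈ (data hm).iA.range) p

lemma last_mem (p : ℤ) : c (m + 1) (m + 1) ^ p ∈ parts hm false :=
  zpow_mem (MonoidHom.mem_range.2 ⟨_, data_iB hm le_rfl⟩ : _ ∈ (data hm).iB.range) p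

lemma conj_first_not_mem {p : ℤ} (hp : p ≠ 0) {k : Chain (m + 1)} (hk : k ∈ parts hm true) :
    k⁻¹ * c (m + 1) 0 ^ p * k ∉ parts hm false := by
  rintro ⟨b, hb⟩
  obtain ⟨a, rfl⟩ := hk
  rw [← data_iA hm, ← map_zpow, ← map_inv, ← map_mul, ← map_mul] at hb
  obtain ⟨n, h1, -⟩ := data_inter hm hb.symm
  exact hp (height_eq_zero (h := 1) (by simpa using h1))

lemma first_not_mem {p : ℤ} (hp : p ≠ 0) : c (m + 1) 0 ^ p ∉ parts hm false := by
  simpa using conj_first_not_mem hm hp (one_mem _)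

lemma last_not_mem {p : ℤ} (hp : p ≠ 0) : c (m + 1) (m + 1) ^ p ∉ parts hm true := by
  rintro ⟨a, ha⟩
  rw [← data_iB hm le_rfl, ← map_zpow] at ha
  obtain ⟨n, -, h2⟩ := data_inter hm ha
  exact hp (hm.indep _ _ h2.symm).2

lemma first_fixed_unique {p : ℤ} (hp : p ≠ 0) {v : IsAmalgam.BSVertex (parts hm)}
    (hv : c (m + 1) 0 ^ p • v = v) : v = Sum.inl ((1 : Chain (m + 1)) : _ ⧸ parts hm true) :=
  (parts_isAmalgam hm).fixed_unique (first_mem hm p) (fun _ => conj_first_not_mem hm hp) hv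

include hm in
lemma good_succ : Good (m + 1) := by
  constructor
  · intro p q h
    constructor
    · by_contra hp
      exact first_not_mem hm hp (h ▸ last_mem hm q)
    · by_contra hq
      exact last_not_mem hm hq (h ▸ first_mem hm p)
  · intro p q g hp h
    have h1 : c (m + 1) 0 ^ p • (g • (Sum.inl ((1 : Chain (m + 1)) : _ ⧸ parts hm true) :
        IsAmalgam.BSVertex (parts hm))) = g • Sum.inl ((1 : Chain (m + 1)) : _ ⧸ parts hm true) := by
      rw [← inv_smul_eq_iff, ← mul_smul, ← mul_smul, h, IsAmalgam.fix_inl]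
      simpa using first_mem hm q
    have h2 := first_fixed_unique hm hp h1
    rw [IsAmalgam.fix_inl, inv_one, one_mul, mul_one] at h2
    obtain ⟨a, rfl⟩ := h2
    rw [← data_iA hm, ← map_zpow, ← map_zpow, ← map_inv, ← map_mul, ← map_mul] at h
    obtain ⟨r, hr⟩ := good_one.malnormal p q a hp ((data hm).iA_injective h)
    refine ⟨r, ?_⟩
    rw [← hr, map_zpow, data_iA]
  · refine (parts_isAmalgam hm).titsAlt ?_ ?_
    · rintro a b g - - hb hb' hg hg' - hbg
      obtain ⟨a, rfl⟩ := hg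
      obtain ⟨b, rfl⟩ := hb
      obtain ⟨g, hg⟩ := hg'
      obtain ⟨n, rfl, rfl⟩ := data_inter hm hg.symm
      rw [← hg, ← map_inv, ← map_mul, ← map_mul] at hbg
      obtain ⟨a', ha'⟩ := hbg
      obtain ⟨n', -, h⟩ := data_inter hm ha'
      by_cases hn : n = 0
      · rw [hn, zpow_zero, map_one]
      exfalso
      obtain ⟨r, rfl⟩ := hm.malnormal n n' b hn h
      apply hb'
      refine ⟨c 1 1 ^ r, ?_⟩
      obtain ⟨z, hz⟩ : ∃ z, (data hm).φA z = c 1 1 ^ r ∧ (data hm).φB z = c m 0 ^ r := by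
        refine ⟨Multiplicative.ofAdd r, ?_, ?_⟩
        · rw [data, (exists_data hm).choose_spec.1]; rfl
        · rw [data, (exists_data hm).choose_spec.2.1]; rfl
      change _ = (data hm).iB (c m 0 ^ r)
      rw [← hz.1, ← hz.2, (data hm).comm]
    · rintro (_ | _)
      · exact hm.tits.range (data hm).iB_injective
      · exact good_one.tits.range (data hm).iA_injective

end Step

lemma good {m : ℕ} (hm : 1 ≤ m) : Good m := by
  induction m, hm using Nat.le_induction with
  | base => exact good_one
  | succ m _ ih => exact good_succ ih

/-- The homomorphism from the free group onto the subgroup generated by the extreme generators. -/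
def ends (m : ℕ) : FreeGroup (Fin 2) →* Chain m := FreeGroup.lift ![c m 0, c m m]

lemma ends_zero (m : ℕ) : ends m (FreeGroup.of 0) = c m 0 := by simp [ends]

lemma ends_one (m : ℕ) : ends m (FreeGroup.of 1) = c m m := by simp [ends]

/-- The free factors of the free group of rank two. -/
def freeParts : Bool → Subgroup (FreeGroup (Fin 2)) :=
  pairS (Subgroup.zpowers (FreeGroup.of 0)) (Subgroup.zpowers (FreeGroup.of 1))

lemma exists_exponent (i : Fin 2) : ∃ e : FreeGroup (Fin 2) →* Multiplicative ℤ,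
    ∀ j, e (FreeGroup.of j) = if j = i then Multiplicative.ofAdd 1 else 1 :=
  ⟨FreeGroup.lift _, fun _ => FreeGroup.lift_apply_of⟩

lemma freeIn_ends {m : ℕ} (hm : Good m) : FreeIn (parts hm) freeParts (ends (m + 1)) where
  amalgam := parts_isAmalgam hm
  top' T h0 h1 := by
    rw [eq_top_iff, ← FreeGroup.closure_range_of, Subgroup.closure_le]
    rintro _ ⟨i, rfl⟩
    fin_cases i
    · exact h0 (Subgroup.mem_zpowers _)
    · exact h1 (Subgroup.mem_zpowers _)
  base' := by
    rintro x ⟨p, rfl⟩ ⟨q, hq⟩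
    obtain ⟨e, he⟩ := exists_exponent 0
    have := congrArg (fun x => Multiplicative.toAdd (e x)) hq
    simp only [map_zpow, he, if_true] at this
    have hp : p = 0 := by simpa using this.symm
    simp [hp]
  map := by
    rintro (_ | _) x ⟨p, rfl⟩ hx <;> dsimp only at hx ⊢
    · have hp : p ≠ 0 := by rintro rfl; exact hx (zpow_zero _)
      rw [map_zpow, ends_one]
      exact ⟨last_mem hm p, last_not_mem hm hp⟩
    · have hp : p ≠ 0 := by rintro rfl; exact hx (zpow_zero _)
      rw [map_zpow, ends_zero]
      exact ⟨first_mem hm p, first_not_mem hm hp⟩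

lemma mem_range_of_conj {m : ℕ} (hm : Good m) {p : ℤ} (hp : p ≠ 0) {b : Chain (m + 1)}
    {w : FreeGroup (Fin 2)} (h : b⁻¹ * c (m + 1) 0 ^ p * b = ends (m + 1) w) :
    b ∈ (ends (m + 1)).range := by
  have hF := freeIn_ends hm
  have hb : c (m + 1) 0 ^ p • FreeIn.baseVertex (parts hm) true =
    FreeIn.baseVertex (parts hm) true := FreeIn.smul_baseVertex.2 (first_mem hm p)
  obtain ⟨k, u, hk⟩ := hF.exists_conj_mem (w := w) (x := b⁻¹ • FreeIn.baseVertex _ true) (by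
    rw [← h, mul_smul, smul_inv_smul, mul_smul, hb])
  have h1 := FreeIn.smul_baseVertex.2 (hF.map_mem hk)
  simp only [map_mul, map_inv, ← h] at h1
  have h2 := first_fixed_unique hm hp
    (v := (b * ends (m + 1) k) • FreeIn.baseVertex (parts hm) u) (by
      rw [← inv_smul_eq_iff, ← mul_smul, ← mul_smul]
      convert h1 using 2
      group)
  have hu := congrArg Sum.isLeft h2
  rw [FreeIn.isLeft_baseVertex] at hu
  have : u = true := hu
  subst this
  obtain ⟨q, hq⟩ := hk
  have hq' := congrArg (ends (m + 1)) hq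
  simp only [map_zpow, ends_zero, map_mul, map_inv, ← h] at hq'
  obtain ⟨r, hr⟩ := (good_succ hm).malnormal p q (b * ends (m + 1) k) hp (by rw [hq']; group)
  refine ⟨FreeGroup.of 0 ^ r * k⁻¹, ?_⟩
  rw [map_mul, map_zpow, ends_zero, map_inv, mul_inv_eq_iff_eq_mul]
  exact hr

lemma exists_conj_last {m : ℕ} (hm : Good m) {a : Chain (m + 1 + 1)}
    (ha : a ∉ (ends (m + 1 + 1)).range)
    {w w' : FreeGroup (Fin 2)} (h : a⁻¹ * ends (m + 1 + 1) w * a = ends (m + 1 + 1) w') :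
    ∃ (k : FreeGroup (Fin 2)) (p : ℤ), w = k * FreeGroup.of 1 ^ p * k⁻¹ := by
  have hm' := good_succ hm
  have hF := freeIn_ends hm'
  rcases hF.conj_alternative h with ⟨k, u, hu⟩ |
    ⟨k, k', l₁, ⟨r₁, rfl⟩, l₂, ⟨r₂, rfl⟩, j₁, ⟨s₁, rfl⟩, j₂, ⟨s₂, rfl⟩, hne, hd, h1, h2⟩
  · cases u
    · obtain ⟨p, hp⟩ := hu
      dsimp only at hp
      exact ⟨k, p, by rw [hp]; group⟩
    · obtain ⟨p, hp⟩ := hu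
      dsimp only at hp
      have hw : w = k * FreeGroup.of 0 ^ p * k⁻¹ := by rw [hp]; group
      by_cases hp0 : p = 0
      · exact ⟨1, 0, by rw [hw, hp0]; simp⟩
      exfalso
      apply ha
      have := mem_range_of_conj hm' hp0 (b := (ends (m + 1 + 1) k)⁻¹ * a) (w := w') (by
        rw [← h, hw]
        simp only [map_mul, map_inv, map_zpow, ends_zero]
        group)
      exact (Subgroup.mul_mem_cancel_left _ (inv_mem (MonoidHom.mem_range.2 ⟨k, rfl⟩))).1 this
  · exfalso
    dsimp only at hne h1 h2
    simp only [map_zpow, ends_one] at h1 h2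
    obtain ⟨d, hd⟩ := hd
    rw [← hd] at h1 h2
    have key : ∀ s r : ℤ, (c (m + 1 + 1) (m + 1 + 1) ^ s)⁻¹ * (data hm').iB d *
        c (m + 1 + 1) (m + 1 + 1) ^ r ∈ parts hm' true →
        ∃ n : ℤ, d = ends (m + 1) (FreeGroup.of 1 ^ s * FreeGroup.of 0 ^ n *
          FreeGroup.of 1 ^ (-r)) := by
      rintro s r ⟨x, hx⟩
      rw [← data_iB hm' le_rfl, ← map_zpow, ← map_zpow, ← map_inv, ← map_mul, ← map_mul] at hx
      obtain ⟨n, -, hn⟩ := data_inter hm' hx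
      refine ⟨n, ?_⟩
      simp only [map_mul, map_zpow, ends_one, ends_zero, ← hn]
      group
    obtain ⟨n₁, e₁⟩ := key _ _ h1
    obtain ⟨n₂, e₂⟩ := key _ _ h2
    have e := (freeIn_ends hm).injective (e₁.symm.trans e₂)
    obtain ⟨x0, hx0⟩ := exists_exponent 0
    obtain ⟨x1, hx1⟩ := exists_exponent 1
    have f0 := congrArg (fun x => Multiplicative.toAdd (x0 x)) e
    have f1 := congrArg (fun x => Multiplicative.toAdd (x1 x)) e
    have hr : r₂ - r₁ ≠ 0 := by
      intro hr
      apply hne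
      congr 1
      omega
    have hn : n₁ = n₂ := by simpa [hx0] using f0
    subst hn
    have hs : s₁ - r₁ = s₂ - r₂ := by simpa [hx1, sub_eq_add_neg] using f1
    by_cases hn : n₁ = 0
    · subst hn
      apply ha
      have hdr : (data hm').iB d ∈ (ends (m + 1 + 1)).range := by
        refine ⟨FreeGroup.of 1 ^ (s₁ - r₁), ?_⟩
        rw [e₁]
        simp only [map_zpow, ends_one, zpow_zero, mul_one, ← zpow_add]
        rw [data_iB hm' le_rfl, sub_eq_add_neg]
      rw [hd] at hdr
      rw [Subgroup.mul_mem_cancel_right _ (MonoidHom.mem_range.2 ⟨k', rfl⟩)] at hdr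
      exact (Subgroup.mul_mem_cancel_left _ (inv_mem (MonoidHom.mem_range.2 ⟨k, rfl⟩))).1 hdr
    · have e' := congrArg (ends (m + 1)) e
      simp only [map_mul, map_zpow, ends_one, ends_zero] at e'
      obtain ⟨t, ht⟩ := hm'.malnormal n₁ n₁ (c (m + 1) (m + 1) ^ (r₂ - r₁)) hn (by
        obtain rfl : s₁ = s₂ + (r₁ - r₂) := by omega
        have := congrArg (fun z => c (m + 1) (m + 1) ^ (-s₂) * z * c (m + 1) (m + 1) ^ r₂) e'
        convert this using 1 <;> group)
      have := (hm'.indep _ _ ht).2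
      omega

end Chain

namespace Chain

/-- The homomorphism `ends` with the two generators exchanged. -/
def endsSwap (m : ℕ) : FreeGroup (Fin 2) →* Chain m :=
  (ends m).comp (FreeGroup.freeGroupCongr (Equiv.swap 0 1)).toMonoidHom

lemma endsSwap_zero (m : ℕ) : endsSwap m (FreeGroup.of 0) = c m m := by simp [endsSwap, ends]

lemma endsSwap_one (m : ℕ) : endsSwap m (FreeGroup.of 1) = c m 0 := by simp [endsSwap, ends]

lemma endsSwap_apply (m : ℕ) (w : FreeGroup (Fin 2)) :
    endsSwap m w = ends m (FreeGroup.freeGroupCongr (Equiv.swap 0 1) w) := rfl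

lemma endsSwap_range (m : ℕ) : (endsSwap m).range = (ends m).range := by
  ext x
  constructor
  · rintro ⟨w, rfl⟩
    exact ⟨_, rfl⟩
  · rintro ⟨w, rfl⟩
    exact ⟨(FreeGroup.freeGroupCongr (Equiv.swap 0 1)).symm w, by
      rw [endsSwap_apply, MulEquiv.apply_symm_apply]⟩

end Chain

open Chain

lemma higman_rel {n : ℕ} (i : ZMod n) :
    (PresentedGroup.of i : HigmanGroup n) * PresentedGroup.of (i + 1) * (PresentedGroup.of i)⁻¹ =
      PresentedGroup.of (i + 1) ^ 2 := by
  have := PresentedGroup.one_of_mem (rels := higmanRels n) ⟨i, rfl⟩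
  rw [map_mul, map_pow, map_inv, inv_pow, mul_inv_eq_one, map_mul, map_mul, map_inv] at this
  exact this

lemma exists_higman_data (m : ℕ) (hm : 1 ≤ m) :
    ∃ D : AmalgamData (HigmanGroup (m + 3)) (Chain (m + 1)) (Chain 2) (FreeGroup (Fin 2)),
      D.φA = ends (m + 1) ∧ D.φB = endsSwap 2 := by
  obtain ⟨iA, hA⟩ := exists_lift (m + 1)
    (fun i => (PresentedGroup.of (i : ZMod (m + 3)) : HigmanGroup (m + 3)))
    fun i _ => by push_cast; exact higman_rel _
  obtain ⟨iB, hB⟩ := exists_lift 2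
    (fun i => (PresentedGroup.of ((m + 1 + i : ℕ) : ZMod (m + 3)) : HigmanGroup (m + 3)))
    fun i _ => by rw [← add_assoc, Nat.cast_succ (m + 1 + i)]; exact higman_rel _
  have hz : ((m + 3 : ℕ) : ZMod (m + 3)) = 0 := ZMod.natCast_self _
  have hA0 := hA 0 (Nat.zero_le _)
  have hA1 := hA (m + 1) le_rfl
  have hB0 := hB 0 (Nat.zero_le _)
  have hB1 := hB 1 one_le_two
  have hB2 := hB 2 le_rfl
  have hval : ∀ i : ZMod (m + 3), ∃ j < m + 3, i = (j : ZMod (m + 3)) := fun i =>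
    ⟨i.val, i.val_lt, (ZMod.natCast_zmod_val i).symm⟩
  refine ⟨⟨ends (m + 1), endsSwap 2, iA, iB, (freeIn_ends (good hm)).injective, ?_, ?_, ?_, ?_⟩,
    rfl, rfl⟩
  · exact (freeIn_ends good_one).injective.comp (MulEquiv.injective _)
  · intro w
    have : iA.comp (ends (m + 1)) = iB.comp (endsSwap 2) := by
      apply FreeGroup.ext_hom
      intro i
      fin_cases i
      · change iA (ends (m + 1) (FreeGroup.of 0)) = iB (endsSwap 2 (FreeGroup.of 0))
        rw [ends_zero, endsSwap_zero, hA0, hB2, hz, Nat.cast_zero]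
      · change iA (ends (m + 1) (FreeGroup.of 1)) = iB (endsSwap 2 (FreeGroup.of 1))
        rw [ends_one, endsSwap_one, hA1, hB0]
    exact DFunLike.congr_fun this w
  · intro T h1 h2
    rw [eq_top_iff, ← PresentedGroup.closure_range_of, Subgroup.closure_le]
    rintro _ ⟨i, rfl⟩
    obtain ⟨j, hj, rfl⟩ := hval i
    by_cases hj' : j ≤ m + 1
    · exact h1 ⟨_, hA j hj'⟩
    · obtain rfl : j = m + 1 + 1 := by omega
      exact h2 ⟨_, hB1⟩
  · intro P _ α β h
    have h0 : α (c (m + 1) 0) = β (c 2 2) := by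
      simpa only [ends_zero, endsSwap_zero] using h (FreeGroup.of 0)
    have h1 : α (c (m + 1) (m + 1)) = β (c 2 0) := by
      simpa only [ends_one, endsSwap_one] using h (FreeGroup.of 1)
    let g : ZMod (m + 3) → P := fun i => if i.val ≤ m + 1 then α (c (m + 1) i.val) else β (c 2 1)
    have gA : ∀ j ≤ m + 1, g (j : ZMod (m + 3)) = α (c (m + 1) j) := by
      intro j hj
      simp only [g, ZMod.val_natCast]
      rw [Nat.mod_eq_of_lt (by omega), if_pos hj]
    have gB : ∀ j ≤ 2, g ((m + 1 + j : ℕ) : ZMod (m + 3)) = β (c 2 j) := by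
      intro j hj
      interval_cases j
      · rw [add_zero, gA _ le_rfl, h1]
      · simp only [g, ZMod.val_natCast]
        rw [Nat.mod_eq_of_lt (by omega), if_neg (by omega)]
      · have := gA 0 (Nat.zero_le _)
        rw [Nat.cast_zero] at this
        rw [hz, this, h0]
    have hg : ∀ r ∈ higmanRels (m + 3), FreeGroup.lift g r = 1 := by
      rintro _ ⟨i, rfl⟩
      simp only [map_mul, map_inv, map_pow, FreeGroup.lift_apply_of]
      rw [inv_pow, mul_inv_eq_one]
      obtain ⟨j, hj, rfl⟩ := hval i
      rw [← Nat.cast_succ]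
      by_cases hj' : j < m + 1
      · rw [gA j hj'.le, gA (j + 1) hj', ← map_inv, ← map_mul, ← map_mul, rel hj', map_pow]
      · obtain ⟨k, rfl⟩ := Nat.exists_eq_add_of_le (not_lt.1 hj')
        rw [Nat.succ_eq_add_one, add_assoc (m + 1) k 1, gB k (by omega), gB (k + 1) (by omega), ← map_inv, ← map_mul,
          ← map_mul, rel (by omega), map_pow]
    refine ⟨PresentedGroup.toGroup hg, fun a => ?_, fun b => ?_⟩
    · have : (PresentedGroup.toGroup hg).comp iA = α := by
        apply hom_ext
        intro i hi
        rw [MonoidHom.comp_apply, hA i hi, PresentedGroup.toGroup.of, gA i hi]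
      exact DFunLike.congr_fun this a
    · have : (PresentedGroup.toGroup hg).comp iB = β := by
        apply hom_ext
        intro i hi
        rw [MonoidHom.comp_apply, hB i hi, PresentedGroup.toGroup.of, gB i hi]
      exact DFunLike.congr_fun this b

lemma higman_titsAlt (m : ℕ) : TitsAlt (HigmanGroup (m + 1 + 1 + 3)) := by
  have hm : Good (m + 1) := good (Nat.le_add_left _ _)
  obtain ⟨D, hA, hB⟩ := exists_higman_data (m + 1 + 1) (Nat.le_add_left _ _)
  refine D.isAmalgam.titsAlt ?_ ?_
  · rintro _ _ _ ⟨a, rfl⟩ ha ⟨b, rfl⟩ hb ⟨g, rfl⟩ ⟨g', hg⟩ ⟨y, hy⟩ ⟨x, hx⟩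
    obtain ⟨w, rfl, rfl⟩ := D.inter hg.symm
    rw [← hg] at hx
    simp only [← map_mul, ← map_inv] at hx hy
    obtain ⟨w₁, hw₁, -⟩ := D.inter hy.symm
    obtain ⟨w₂, -, hw₂⟩ := D.inter hx
    rw [hA] at hw₁
    rw [hB, endsSwap_apply, endsSwap_apply] at hw₂
    obtain ⟨k, p, rfl⟩ := exists_conj_last hm (a := a) (by
      rw [← hA]
      rintro ⟨z, rfl⟩
      exact ha ⟨D.φB z, (D.comm z).symm⟩) hw₁.symm
    by_cases hp : p = 0
    · simp [hp]
    exfalso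
    have hk : endsSwap 2 k * ((endsSwap 2 k)⁻¹ * b) ∈ (ends 2).range := by
      refine mul_mem (by rw [← endsSwap_range]; exact ⟨k, rfl⟩)
        (mem_range_of_conj good_one hp (w := FreeGroup.freeGroupCongr (Equiv.swap 0 1) w₂) ?_)
      rw [hw₂, ← endsSwap_apply]
      simp only [map_mul, map_inv, map_zpow, endsSwap_one]
      group
    rw [mul_inv_cancel_left, ← endsSwap_range, ← hB] at hk
    obtain ⟨z, rfl⟩ := hk
    exact hb ⟨D.φA z, D.comm z⟩
  · rintro (_ | _)
    · exact (good one_le_two).tits.range D.iB_injective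
    · exact (good (Nat.le_add_left _ _)).tits.range D.iA_injective

theorem higman_tits_alternative (n : ℕ) (hn : 5 ≤ n) (H : Subgroup (HigmanGroup n)) :
    IsCyclic H ∨ (∃ f : H →* BS12, Function.Injective f) ∨ HasFreeSubgroup H := by
  obtain ⟨m, rfl⟩ := Nat.exists_eq_add_of_le' hn
  exact (higman_titsAlt m).alt H H.subtype Subtype.coe_injective
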